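/- arXiv:1506.07630 — 11 statements merged into one kernel-verified Lean document; each statement's English description precedes it below -/
import Mathlib

section
/- For every pair of complex numbers a, b there exists a complex number θ with |θ| = 1 such that |1 + θ·a + θ²·b| ≥ 1 + (1/24)·(|a| + |b|). -/
/-- Every complex number is carried to its norm by the square of some unit complex number. -/
lemma exists_unit_sq_mul_eq_norm (c : ℂ) : ∃ u : ℂ, ‖u‖ = 1 ∧ u ^ 2 * c = (‖c‖ : ℂ) := by
  refine ⟨Complex.exp (((-c.arg / 2 : ℝ) : ℂ) * Complex.I),
    Complex.norm_exp_ofReal_mul_I _, ?_⟩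
  conv_lhs => arg 2; rw [← Complex.norm_mul_exp_arg_mul_I c]
  rw [← Complex.exp_nat_mul, mul_left_comm, ← Complex.exp_add]
  have h : ((2 : ℕ) : ℂ) * (((-c.arg / 2 : ℝ) : ℂ) * Complex.I) + c.arg * Complex.I = 0 := by
    push_cast
    ring
  rw [h, Complex.exp_zero, mul_one]

/-- A bound for `1 + a z + b z ^ 2` on the unit circle controls the leading coefficient. -/
lemma one_add_norm_leading_le {a b : ℂ} {M : ℝ}
    (hM : ∀ z : ℂ, ‖z‖ = 1 → ‖1 + z * a + z ^ 2 * b‖ ≤ M) : 1 + ‖b‖ ≤ M := by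
  obtain ⟨u, hu, hub⟩ := exists_unit_sq_mul_eq_norm b
  have h₁ := (Complex.re_le_norm _).trans (hM u hu)
  have h₂ := (Complex.re_le_norm _).trans (hM (-u) (by rwa [norm_neg]))
  rw [neg_sq] at h₂
  simp only [hub, neg_mul, Complex.add_re, Complex.neg_re, Complex.one_re,
    Complex.ofReal_re] at h₁ h₂
  linarith

/-- A bound for `1 + a z + b z ^ 2` on the unit circle controls the middle coefficient: average
over the points `u`, `i u`, `-i u` with weights `1/2`, `1/4`, `1/4`. -/
lemma one_add_half_norm_middle_le {a b : ℂ} {M : ℝ}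
    (hM : ∀ z : ℂ, ‖z‖ = 1 → ‖1 + z * a + z ^ 2 * b‖ ≤ M) : 1 + ‖a‖ / 2 ≤ M := by
  obtain ⟨v, hv, hva⟩ := exists_unit_sq_mul_eq_norm a
  have hu : ‖v ^ 2‖ = 1 := by rw [norm_pow, hv, one_pow]
  generalize v ^ 2 = u at hva hu
  have h₁ := (Complex.re_le_norm _).trans (hM u hu)
  have h₂ := (Complex.re_le_norm _).trans (hM (Complex.I * u) (by simp [hu]))
  have h₃ := (Complex.re_le_norm _).trans (hM (-Complex.I * u) (by simp [hu]))
  simp only [mul_pow, neg_sq, Complex.I_sq, mul_assoc, hva, neg_mul, one_mul, Complex.add_re,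
    Complex.neg_re, Complex.one_re, Complex.ofReal_re] at h₁ h₂ h₃
  linarith

/-- Lemma (Section 5): for every pair of complex numbers `a, b` there exists `θ` on the
unit circle such that `|1 + θ·a + θ²·b| ≥ 1 + (1/24)·(|a| + |b|)`. -/
theorem unit_circle_quadratic_lower_bound (a b : ℂ) :
    ∃ θ : ℂ, ‖θ‖ = 1 ∧ 1 + (1 / 24) * (‖a‖ + ‖b‖) ≤ ‖1 + θ * a + θ ^ 2 * b‖ := by
  rcases eq_or_ne (‖a‖ + ‖b‖) 0 with h₀ | h₀
  · have ha : a = 0 := norm_eq_zero.1 (by linarith [norm_nonneg a, norm_nonneg b])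
    have hb : b = 0 := norm_eq_zero.1 (by linarith [norm_nonneg a, norm_nonneg b])
    exact ⟨1, norm_one, by simp [ha, hb]⟩
  · by_contra! h
    have hb := one_add_norm_leading_le fun z hz => (h z hz).le
    have ha := one_add_half_norm_middle_le fun z hz => (h z hz).le
    exact h₀ (by linarith [norm_nonneg a, norm_nonneg b])
end

section
/- Let a, b be complex numbers with |a| ≤ |b|/2. Then there exists a complex number θ with |θ| = 1 such that |1 + θ·a + θ²·b| ≥ 1 + |b| − |a|, and consequently |1 + θ·a + θ²·b| ≥ 1 + (1/3)·(|a| + |b|). -/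
/-- First case in the proof of the Lemma of Section 5: if `|a| ≤ |b|/2` then some `θ` on the
unit circle satisfies `|1 + θ·a + θ²·b| ≥ 1 + |b| − |a|`, and consequently
`|1 + θ·a + θ²·b| ≥ 1 + (1/3)·(|a| + |b|)`. -/
theorem unit_circle_quadratic_lower_bound_case_one (a b : ℂ) (hab : ‖a‖ ≤ ‖b‖ / 2) :
    ∃ θ : ℂ, ‖θ‖ = 1 ∧ 1 + ‖b‖ - ‖a‖ ≤ ‖1 + θ * a + θ ^ 2 * b‖ ∧
      1 + (1 / 3) * (‖a‖ + ‖b‖) ≤ ‖1 + θ * a + θ ^ 2 * b‖ := by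
  obtain ⟨c, hc, hcb⟩ := Complex.exists_norm_eq_mul_self b
  obtain ⟨θ, hθ⟩ := IsAlgClosed.exists_pow_nat_eq c two_pos
  have hθ_norm : ‖θ‖ = 1 := by
    rw [← pow_eq_one_iff_of_nonneg (norm_nonneg θ) two_ne_zero, ← norm_pow, hθ, hc]
  have h_main : ‖(1 : ℂ) + θ ^ 2 * b‖ = 1 + ‖b‖ := by
    rw [hθ, ← hcb]
    exact_mod_cast Complex.norm_of_nonneg (by positivity : 0 ≤ 1 + ‖b‖)
  have h_bound : 1 + ‖b‖ - ‖a‖ ≤ ‖1 + θ * a + θ ^ 2 * b‖ := by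
    have h := norm_sub_le (1 + θ * a + θ ^ 2 * b) (θ * a)
    rw [add_right_comm, add_sub_cancel_right, h_main, norm_mul, hθ_norm, one_mul] at h
    rw [add_right_comm]
    linarith
  exact ⟨θ, hθ_norm, h_bound, by linarith⟩
end

section
/- For every pair of complex numbers a, b there exists a complex number θ with |θ| = 1 such that |1 + θ·a + θ²·b| ≥ 1 + |a|/4 − |b|/16. -/
/-- A quadratic polynomial with constant term `1` takes, somewhere on the circle of radius `r`,
a value of norm at least `1 + r‖a‖ - r²‖b‖`. -/
theorem exists_norm_eq_le_norm_quadratic (a b : ℂ) {r : ℝ} (hr : 0 ≤ r) :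
    ∃ z : ℂ, ‖z‖ = r ∧ 1 + r * ‖a‖ - r ^ 2 * ‖b‖ ≤ ‖1 + z * a + z ^ 2 * b‖ := by
  obtain ⟨c, hc, hca⟩ := RCLike.exists_norm_eq_mul_self a
  have hz : ‖(r : ℂ) * c‖ = r := by simp [hc, abs_of_nonneg hr]
  refine ⟨r * c, hz, ?_⟩
  have hlin : ‖1 + (r : ℂ) * c * a‖ = 1 + r * ‖a‖ := by
    have hreal : 1 + (r : ℂ) * c * a = ((1 + r * ‖a‖ : ℝ) : ℂ) := by
      rw [mul_assoc, ← hca]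
      simp
    rw [hreal, Complex.norm_of_nonneg (by positivity)]
  have hquad : ‖((r : ℂ) * c) ^ 2 * b‖ = r ^ 2 * ‖b‖ := by rw [norm_mul, norm_pow, hz]
  rw [← hlin, ← hquad]
  exact norm_sub_le_norm_add _ _

/-- Second case in the proof of the Lemma of Section 5: for every pair of complex numbers
`a, b` there is `θ` on the unit circle with `|1 + θ·a + θ²·b| ≥ 1 + |a|/4 − |b|/16`. -/
theorem unit_circle_quadratic_lower_bound_case_two (a b : ℂ) :
    ∃ θ : ℂ, ‖θ‖ = 1 ∧ 1 + ‖a‖ / 4 - ‖b‖ / 16 ≤ ‖1 + θ * a + θ ^ 2 * b‖ := by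
  obtain ⟨z, hz, hle⟩ := exists_norm_eq_le_norm_quadratic a b (r := 1 / 4) (by norm_num)
  have hf : Differentiable ℂ fun w : ℂ => 1 + w * a + w ^ 2 * b := by fun_prop
  obtain ⟨θ, hθ, hmax⟩ := Complex.exists_mem_frontier_isMaxOn_norm
    (Metric.isBounded_ball (x := (0 : ℂ)) (r := 1)) (Metric.nonempty_ball.2 one_pos)
    hf.diffContOnCl
  rw [frontier_ball _ one_ne_zero, mem_sphere_zero_iff_norm] at hθ
  have hz_ball : z ∈ Metric.ball (0 : ℂ) 1 := by
    rw [mem_ball_zero_iff, hz]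
    norm_num
  have hzθ : ‖1 + z * a + z ^ 2 * b‖ ≤ ‖1 + θ * a + θ ^ 2 * b‖ := hmax (subset_closure hz_ball)
  exact ⟨θ, hθ, by linarith⟩
end

section
/- Let c : ℕ → ℂ be completely multiplicative and let X ≥ 1 be a real number. Then there exists a sequence of real numbers (t_ν) with t_ν → +∞ such that for every natural number n with 1 ≤ n ≤ X, c(n)·n^{−i·t_ν} → |c(n)| as ν → ∞. -/
open Filter Topology

/-- The mean value over `[T, T + L]` of an oscillating exponential tends to `0`. -/
lemma tendsto_mean_exp_of_ne_zero {μ : ℝ} (hμ : μ ≠ 0) (T : ℝ) :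
    Tendsto (fun L : ℝ => (L : ℂ)⁻¹ * ∫ t in T..T + L, Complex.exp (Complex.I * μ * t))
      atTop (𝓝 0) := by
  have hne : Complex.I * μ ≠ 0 := mul_ne_zero Complex.I_ne_zero (by exact_mod_cast hμ)
  have hexp (x : ℝ) : ‖Complex.exp (Complex.I * μ * x)‖ = 1 := by
    rw [show Complex.I * μ * x = ((μ * x : ℝ) : ℂ) * Complex.I by push_cast; ring]
    exact Complex.norm_exp_ofReal_mul_I _
  have hlim : Tendsto (fun L : ℝ => L⁻¹ * (2 / |μ|)) atTop (𝓝 0) := by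
    simpa using tendsto_inv_atTop_zero.mul_const (2 / |μ|)
  refine squeeze_zero_norm' ?_ hlim
  filter_upwards [eventually_gt_atTop 0] with L hL
  rw [integral_exp_mul_complex hne, norm_mul, norm_inv, Complex.norm_real, Real.norm_eq_abs,
    abs_of_pos hL, norm_div]
  have hden : ‖Complex.I * μ‖ = |μ| := by simp
  rw [hden]
  gcongr
  refine (norm_sub_le _ _).trans ?_
  rw [hexp, hexp]
  norm_num

/-- A trigonometric polynomial with distinct frequencies has mean square `∑ ‖b j‖ ^ 2`, so any
bound for its square on a half-line bounds this sum. -/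
lemma sum_sq_norm_le_of_sq_norm_trigPoly_le {J : Type*} (s : Finset J) (b : J → ℂ) (l : J → ℝ)
    (hl : Set.InjOn l s) {T B : ℝ}
    (h : ∀ t : ℝ, T ≤ t → ‖∑ j ∈ s, b j * Complex.exp (-Complex.I * t * l j)‖ ^ 2 ≤ B) :
    ∑ j ∈ s, ‖b j‖ ^ 2 ≤ B := by
  classical
  let F : ℝ → ℂ := fun t => ∑ j ∈ s, ∑ m ∈ s,
    b j * (starRingEnd ℂ) (b m) * Complex.exp (Complex.I * (l m - l j : ℝ) * t)
  have hF (t : ℝ) :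
      F t = ((‖∑ j ∈ s, b j * Complex.exp (-Complex.I * t * l j)‖ ^ 2 : ℝ) : ℂ) := by
    rw [Complex.ofReal_pow, ← Complex.mul_conj', map_sum, Finset.sum_mul_sum]
    refine Finset.sum_congr rfl fun j _ => Finset.sum_congr rfl fun m _ => ?_
    rw [map_mul, ← Complex.exp_conj, mul_mul_mul_comm, ← Complex.exp_add]
    congr 2
    simp only [map_mul, map_neg, Complex.conj_I, Complex.conj_ofReal]
    push_cast
    ring
  have hint (L : ℝ) : ∫ t in T..T + L, F t = ∑ j ∈ s, ∑ m ∈ s, b j * (starRingEnd ℂ) (b m) *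
      ∫ t in T..T + L, Complex.exp (Complex.I * (l m - l j : ℝ) * t) := by
    simp only [F]
    rw [intervalIntegral.integral_finsetSum]
    · refine Finset.sum_congr rfl fun j _ => ?_
      rw [intervalIntegral.integral_finsetSum]
      · simp only [intervalIntegral.integral_const_mul]
      · intro m _
        exact Continuous.intervalIntegrable (by fun_prop) _ _
    · intro j _
      exact Continuous.intervalIntegrable (by fun_prop) _ _
  have hmean : Tendsto (fun L : ℝ => (L : ℂ)⁻¹ * ∫ t in T..T + L, F t) atTop
      (𝓝 (∑ j ∈ s, ∑ m ∈ s, b j * (starRingEnd ℂ) (b m) * if m = j then 1 else 0)) := by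
    simp only [hint, Finset.mul_sum]
    refine tendsto_finsetSum _ fun j hj => tendsto_finsetSum _ fun m hm => ?_
    simp only [mul_left_comm _ (b j * (starRingEnd ℂ) (b m))]
    refine Tendsto.const_mul _ ?_
    split_ifs with hmj
    · subst hmj
      refine tendsto_const_nhds.congr' ?_
      filter_upwards [eventually_gt_atTop 0] with L hL
      have hL' : (L : ℂ) ≠ 0 := by exact_mod_cast hL.ne'
      simp [hL']
    · exact tendsto_mean_exp_of_ne_zero (sub_ne_zero.2 fun e => hmj (hl hm hj e)) T
  have hsum : (∑ j ∈ s, ∑ m ∈ s, b j * (starRingEnd ℂ) (b m) * if m = j then 1 else 0) =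
      ((∑ j ∈ s, ‖b j‖ ^ 2 : ℝ) : ℂ) := by
    push_cast
    refine Finset.sum_congr rfl fun j hj => ?_
    simp [hj, Complex.mul_conj']
  rw [hsum] at hmean
  have hbound : ∀ᶠ L : ℝ in atTop, ‖(L : ℂ)⁻¹ * ∫ t in T..T + L, F t‖ ≤ B := by
    filter_upwards [eventually_gt_atTop 0] with L hL
    have hle : ‖∫ t in T..T + L, F t‖ ≤ B * |T + L - T| := by
      refine intervalIntegral.norm_integral_le_of_norm_le_const fun t ht => ?_
      rw [Set.uIoc_of_le (by linarith)] at ht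
      rw [hF, Complex.norm_real, Real.norm_of_nonneg (by positivity)]
      exact h t ht.1.le
    rw [add_sub_cancel_left, abs_of_pos hL] at hle
    rw [norm_mul, norm_inv, Complex.norm_real, Real.norm_of_nonneg hL.le, inv_mul_le_iff₀ hL]
    linarith
  have hfinal := le_of_tendsto hmean.norm hbound
  rwa [Complex.norm_real, Real.norm_of_nonneg (by positivity)] at hfinal

/-- Expansion of the `k`-th power of `∏ i, (1 + u i * e ^ (-i t l i))`. -/
lemma prod_one_add_pow_eq_trigPoly {ι : Type*} [Fintype ι] [DecidableEq ι]
    (l : ι → ℝ) (u : ι → ℂ) (k : ℕ) (t : ℝ) :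
    ∏ i, (u i * Complex.exp (-Complex.I * t * l i) + 1) ^ k =
      ∑ a ∈ Fintype.piFinset fun _ : ι => Finset.range (k + 1),
        (∏ i, (u i ^ a i * (k.choose (a i) : ℂ))) *
          Complex.exp (-Complex.I * t * (∑ i, a i * l i : ℝ)) := by
  simp only [add_pow, one_pow, mul_one]
  rw [Finset.prod_univ_sum]
  refine Finset.sum_congr rfl fun a _ => ?_
  push_cast
  rw [Finset.mul_sum, Complex.exp_sum, ← Finset.prod_mul_distrib]
  refine Finset.prod_congr rfl fun i _ => ?_
  rw [mul_pow, ← Complex.exp_nat_mul,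
    show (a i : ℂ) * (-Complex.I * t * l i) = -Complex.I * t * (a i * l i) by ring]
  ring

/-- **Kronecker's theorem**: if the frequencies `l i` are linearly independent, the phases
`e ^ (-i t l i)` can be simultaneously aligned with any prescribed ones, for arbitrarily
large `t`. -/
theorem exists_ge_forall_norm_mul_exp_sub_one_lt {ι : Type*} [Fintype ι] (l : ι → ℝ)
    (hl : Function.Injective fun a : ι → ℕ => ∑ i, a i * l i) (u : ι → ℂ)
    (hu : ∀ i, ‖u i‖ = 1) (T : ℝ) {ε : ℝ} (hε : 0 < ε) :
    ∃ t, T ≤ t ∧ ∀ i, ‖u i * Complex.exp (-Complex.I * t * l i) - 1‖ < ε := by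
  classical
  by_contra! hcon
  have hz (t : ℝ) (i : ι) : ‖u i * Complex.exp (-Complex.I * t * l i)‖ = 1 := by
    rw [norm_mul, hu, one_mul,
      show -Complex.I * t * l i = ((-(t * l i) : ℝ) : ℂ) * Complex.I by push_cast; ring]
    exact Complex.norm_exp_ofReal_mul_I _
  have hpar (t : ℝ) (i : ι) : ‖u i * Complex.exp (-Complex.I * t * l i) + 1‖ ^ 2 =
      4 - ‖u i * Complex.exp (-Complex.I * t * l i) - 1‖ ^ 2 := by
    have := parallelogram_law_with_norm ℝ (u i * Complex.exp (-Complex.I * t * l i)) 1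
    rw [hz, norm_one] at this
    linarith
  set r : ℝ := (4 - ε ^ 2) / 4 with hr
  have hr0 : 0 ≤ r := by
    obtain ⟨i, hi⟩ := hcon T le_rfl
    have h1 := hpar T i
    have h2 : ε ^ 2 ≤ ‖u i * Complex.exp (-Complex.I * T * l i) - 1‖ ^ 2 := by gcongr
    have h3 := sq_nonneg ‖u i * Complex.exp (-Complex.I * T * l i) + 1‖
    rw [hr]
    linarith
  have hr1 : r < 1 := by
    rw [hr]
    have := pow_pos hε 2
    linarith
  have hprod (t : ℝ) (ht : T ≤ t) :
      ∏ i, ‖u i * Complex.exp (-Complex.I * t * l i) + 1‖ ^ 2 ≤ r * 4 ^ Fintype.card ι := by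
    obtain ⟨i, hi⟩ := hcon t ht
    have h2 : ε ^ 2 ≤ ‖u i * Complex.exp (-Complex.I * t * l i) - 1‖ ^ 2 := by gcongr
    have hle : ∀ m, ‖u m * Complex.exp (-Complex.I * t * l m) + 1‖ ^ 2 ≤
        (if m = i then r else 1) * 4 := by
      intro m
      rw [hpar]
      split_ifs with hm
      · subst hm
        rw [hr]
        linarith
      · linarith [sq_nonneg ‖u m * Complex.exp (-Complex.I * t * l m) - 1‖]
    refine (Finset.prod_le_prod (fun m _ => by positivity) fun m _ => hle m).trans_eq ?_
    rw [Finset.prod_mul_distrib]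
    simp
  have hmain (k : ℕ) :
      (k.centralBinom : ℝ) ^ Fintype.card ι ≤ (r * 4 ^ Fintype.card ι) ^ k := by
    have hsq := sum_sq_norm_le_of_sq_norm_trigPoly_le
      (Fintype.piFinset fun _ : ι => Finset.range (k + 1))
      (fun a => ∏ i, (u i ^ a i * (k.choose (a i) : ℂ))) (fun a => ∑ i, a i * l i)
      hl.injOn (T := T) (B := (r * 4 ^ Fintype.card ι) ^ k) (by
        intro t ht
        rw [← prod_one_add_pow_eq_trigPoly, Finset.prod_pow, norm_pow, norm_prod, ← pow_mul,
          mul_comm k, pow_mul, ← Finset.prod_pow]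
        exact pow_le_pow_left₀ (by positivity) (hprod t ht) k)
    refine le_trans (le_of_eq ?_) hsq
    simp only [norm_prod, norm_mul, norm_pow, hu, one_pow, one_mul, Complex.norm_natCast,
      ← Finset.prod_pow]
    rw [← Finset.prod_univ_sum (fun _ : ι => Finset.range (k + 1))
      (fun _ j => (k.choose j : ℝ) ^ 2), Finset.prod_const, Finset.card_univ]
    congr 1
    rw [Nat.centralBinom, ← Nat.sum_range_choose_sq]
    push_cast
    rfl
  have hone (k : ℕ) (hk : 0 < k) : 1 ≤ 2 ^ Fintype.card ι * ((k : ℝ) ^ Fintype.card ι * r ^ k) := by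
    have h4 : (4 : ℝ) ^ k ≤ 2 * k * k.centralBinom := by
      exact_mod_cast Nat.four_pow_le_two_mul_self_mul_centralBinom k hk
    have h5 : ((4 : ℝ) ^ k) ^ Fintype.card ι ≤
        (2 * k) ^ Fintype.card ι * (r * 4 ^ Fintype.card ι) ^ k := by
      refine (pow_le_pow_left₀ (by positivity) h4 _).trans ?_
      rw [mul_pow]
      gcongr
      exact hmain k
    have h6 : 0 < ((4 : ℝ) ^ k) ^ Fintype.card ι := by positivity
    refine le_of_mul_le_mul_right ?_ h6
    rw [one_mul]
    refine h5.trans_eq ?_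
    rw [mul_pow, mul_pow, ← pow_mul, ← pow_mul, mul_comm k]
    ring
  have hlim : Tendsto (fun k : ℕ => 2 ^ Fintype.card ι * ((k : ℝ) ^ Fintype.card ι * r ^ k))
      atTop (𝓝 0) := by
    simpa using (tendsto_pow_const_mul_const_pow_of_abs_lt_one (Fintype.card ι)
      (by rwa [abs_of_nonneg hr0])).const_mul ((2 : ℝ) ^ Fintype.card ι)
  have hle : (1 : ℝ) ≤ 0 := ge_of_tendsto hlim <| by
    filter_upwards [eventually_gt_atTop 0] with k hk using hone k hk
  norm_num at hle

/-- Logarithms of distinct primes are linearly independent over `ℕ`. -/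
lemma injective_sum_mul_log_prime (s : Finset ℕ) (hs : ∀ p ∈ s, p.Prime) :
    Function.Injective fun a : s → ℕ => ∑ p, a p * Real.log (p : ℕ) := by
  intro a b hab
  have hpos (a : s → ℕ) : 0 < ∏ p : s, (p : ℕ) ^ a p :=
    Finset.prod_pos fun p _ => pow_pos (hs p p.2).pos _
  have hlog (a : s → ℕ) :
      ∑ p, a p * Real.log (p : ℕ) = Real.log ((∏ p : s, (p : ℕ) ^ a p : ℕ) : ℝ) := by
    push_cast
    rw [Real.log_prod fun (p : s) _ => pow_ne_zero _ (by exact_mod_cast (hs p p.2).ne_zero)]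
    simp
  have hfac (a : s → ℕ) (q : s) : (∏ p : s, (p : ℕ) ^ a p).factorization q = a q := by
    rw [Nat.factorization_prod fun (p : s) _ => pow_ne_zero _ (hs p p.2).ne_zero]
    rw [Finsupp.finsetSum_apply, Finset.sum_eq_single q]
    · simp [(hs q q.2).factorization_self]
    · intro p _ hpq
      have : (p : ℕ) ≠ q := fun h => hpq (Subtype.ext h)
      simp [(hs p p.2).factorization, this]
    · simp
  simp only [hlog] at hab
  have heq := Real.log_injOn_pos (Set.mem_Ioi.2 (by exact_mod_cast hpos a))
    (Set.mem_Ioi.2 (by exact_mod_cast hpos b)) hab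
  funext q
  rw [← hfac a q, ← hfac b q, Nat.cast_injective heq]

/-- The consequence of Kronecker's theorem used in the proof of Theorem 1: for a completely
multiplicative `c : ℕ → ℂ` and `X ≥ 1` there is a sequence `t_ν → +∞` such that
`c(n)·n^{−i·t_ν} → |c(n)|` for every `1 ≤ n ≤ X`. -/
theorem phase_alignment_completely_multiplicative
    (c : ℕ → ℂ) (hc1 : c 1 = 1)
    (hcm : ∀ m n : ℕ, 1 ≤ m → 1 ≤ n → c (m * n) = c m * c n)
    (X : ℝ) (hX : 1 ≤ X) :
    ∃ t : ℕ → ℝ, Tendsto t atTop atTop ∧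
      ∀ n : ℕ, 1 ≤ n → (n : ℝ) ≤ X →
        Tendsto (fun ν => c n * Complex.exp (-Complex.I * (t ν) * Real.log n))
          atTop (𝓝 ((‖c n‖ : ℂ))) := by
  let s : Finset ℕ := (Finset.range (⌊X⌋₊ + 1)).filter Nat.Prime
  let u : ℕ → ℂ := fun p => if c p = 0 then 1 else c p / ‖c p‖
  have hu (p : ℕ) : ‖u p‖ = 1 := by
    by_cases h : c p = 0 <;> simp [u, h]
  have hcu (p : ℕ) : c p = ‖c p‖ * u p := by
    by_cases h : c p = 0
    · simp [h]
    · have : (‖c p‖ : ℂ) ≠ 0 := by simpa using h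
      simp only [u, h, if_false]
      field_simp
  choose t ht htu using fun ν : ℕ => exists_ge_forall_norm_mul_exp_sub_one_lt
    (fun p : s => Real.log (p : ℕ))
    (injective_sum_mul_log_prime s fun p hp => (Finset.mem_filter.1 hp).2)
    (fun p => u p) (fun p => hu p) ν (Nat.one_div_pos_of_nat (α := ℝ) (n := ν))
  refine ⟨t, tendsto_atTop_mono ht tendsto_natCast_atTop_atTop, fun n => ?_⟩
  induction n using Nat.recOnMul with
  | zero => intro h; omega
  | one => intro _ _; simp [hc1]
  | prime p hp =>
    intro _ hpX
    have hps : p ∈ s := Finset.mem_filter.2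
      ⟨Finset.mem_range.2 (Nat.lt_succ_of_le (Nat.le_floor hpX)), hp⟩
    have hlim : Tendsto (fun ν => u p * Complex.exp (-Complex.I * t ν * Real.log p))
        atTop (𝓝 1) := by
      rw [tendsto_iff_norm_sub_tendsto_zero]
      exact squeeze_zero (fun _ => norm_nonneg _) (fun ν => (htu ν ⟨p, hps⟩).le)
        tendsto_one_div_add_atTop_nhds_zero_nat
    have hmul := hlim.const_mul (‖c p‖ : ℂ)
    simpa only [← mul_assoc, ← hcu, mul_one] using hmul
  | mul m n hm hn =>
    intro h1 hmnX
    have hm1 : 1 ≤ m := Nat.pos_of_mul_pos_right h1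
    have hn1 : 1 ≤ n := Nat.pos_of_mul_pos_left h1
    have hmX : (m : ℝ) ≤ X :=
      le_trans (by exact_mod_cast Nat.le_mul_of_pos_right m hn1) hmnX
    have hnX : (n : ℝ) ≤ X :=
      le_trans (by exact_mod_cast Nat.le_mul_of_pos_left n hm1) hmnX
    have hlim := (hm hm1 hmX).mul (hn hn1 hnX)
    rw [hcm m n hm1 hn1, norm_mul, Complex.ofReal_mul]
    refine hlim.congr fun ν => ?_
    rw [Nat.cast_mul, Real.log_mul (by positivity) (by positivity), Complex.ofReal_add, mul_add,
      Complex.exp_add]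
    ring
end

section
/- Let ε > 0, c₀ ≥ 3, and a : ℕ → ℂ with a(1) = 1 and |a(n)| ≤ c₀·n^{ε/2} for all n ≥ 1. Let p be a prime with |a(p)| ≤ p^{ε/2} and p ≥ c₀^{2/ε}, and let m ≥ 2 be an integer. Define b(p^m) = ∑_{l=0}^{m} (−1)^l · a(p)^l · a(p^{m−l}). Then |b(p^m)| ≤ p^{m·ε}. -/
open Finset

/-- Bound on the coefficients `b(p^m) = ∑_{l=0}^m (−1)^l·a(p)^l·a(p^{m−l})` appearing in
the proof of Theorem 1: under the Ramanujan-type hypotheses, `|b(p^m)| ≤ p^{m·ε}`. -/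
theorem b_coefficient_bound
    (ε : ℝ) (hε : 0 < ε) (c₀ : ℝ) (hc₀ : 3 ≤ c₀)
    (a : ℕ → ℂ) (ha1 : a 1 = 1)
    (haR : ∀ n : ℕ, 1 ≤ n → ‖a n‖ ≤ c₀ * (n : ℝ) ^ (ε / 2))
    (p : ℕ) (hp : Nat.Prime p)
    (hap : ‖a p‖ ≤ (p : ℝ) ^ (ε / 2)) (hpc : c₀ ^ (2 / ε) ≤ (p : ℝ))
    (m : ℕ) (hm : 2 ≤ m)
    (b : ℂ) (hb : b = ∑ l ∈ Finset.range (m + 1), (-1 : ℂ) ^ l * (a p) ^ l * a (p ^ (m - l))) :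
    ‖b‖ ≤ (p : ℝ) ^ ((m : ℝ) * ε) := by
  obtain ⟨n, rfl⟩ : ∃ n, m = n + 1 := ⟨m - 1, by omega⟩
  have hp0 : (0 : ℝ) ≤ p := Nat.cast_nonneg p
  set x : ℝ := (p : ℝ) ^ (ε / 2) with hx
  have hcx : c₀ ≤ x := by
    have h := Real.rpow_le_rpow (Real.rpow_nonneg (by linarith) _) hpc (half_pos hε).le
    rwa [← Real.rpow_mul (by linarith), show 2 / ε * (ε / 2) = 1 by field_simp,
      Real.rpow_one] at h
  have hx0 : 0 ≤ x := by linarith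
  have hpow (k : ℕ) : ‖a (p ^ k)‖ ≤ c₀ * x ^ k := by
    have h := haR (p ^ k) (Nat.one_le_pow _ _ hp.pos)
    rwa [Nat.cast_pow, ← Real.rpow_natCast_mul hp0, mul_comm (k : ℝ),
      Real.rpow_mul_natCast hp0] at h
  have hterm : ∀ l ∈ range n, ‖(-1 : ℂ) ^ l * (a p) ^ l * a (p ^ (n + 1 - l))‖ ≤
      x * x ^ (n + 1) := by
    intro l hl
    have hl := mem_range.mp hl
    calc ‖(-1 : ℂ) ^ l * (a p) ^ l * a (p ^ (n + 1 - l))‖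
        = ‖a p‖ ^ l * ‖a (p ^ (n + 1 - l))‖ := by simp
      _ ≤ x ^ l * (x * x ^ (n + 1 - l)) := by
        gcongr
        exact (hpow _).trans (by gcongr)
      _ = x * x ^ (n + 1) := by
        rw [mul_left_comm, ← pow_add, show l + (n + 1 - l) = n + 1 by omega]
  -- The two last terms of the sum cancel because `a 1 = 1`.
  have hb' : b = ∑ l ∈ range n, (-1 : ℂ) ^ l * (a p) ^ l * a (p ^ (n + 1 - l)) := by
    rw [hb, sum_range_succ, sum_range_succ]
    simp only [Nat.add_sub_cancel_left, Nat.sub_self, pow_zero, pow_one, ha1]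
    ring
  have hn : (n : ℝ) ≤ x ^ n := by
    calc (n : ℝ) ≤ 2 ^ n := mod_cast Nat.lt_two_pow_self.le
      _ ≤ x ^ n := by gcongr; linarith
  calc ‖b‖ ≤ n * (x * x ^ (n + 1)) := by
        simpa [hb'] using norm_sum_le_of_le _ hterm
    _ ≤ x ^ n * (x * x ^ (n + 1)) := by gcongr
    _ = x ^ (2 * (n + 1)) := by ring
    _ = (p : ℝ) ^ (((n + 1 : ℕ) : ℝ) * ε) := by
      rw [hx, ← Real.rpow_mul_natCast hp0]
      congr 1
      push_cast
      ring
end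

section
/- Let ε with 0 < ε < 1/2, c₀ ≥ 3, and a : ℕ → ℂ with a(1) = 1 and |a(n)| ≤ c₀·n^{ε/2} for all n ≥ 1. For a prime p with |a(p)| ≤ p^{ε/2} and p ≥ c₀^{2/ε} and an integer m ≥ 2, define b(p^m) = ∑_{l=0}^{m} (−1)^l · a(p)^l · a(p^{m−l}). Then for every real σ > 1/2 + ε: (i) for each such prime p, ∑_{m=2}^{∞} |b(p^m)|·p^{−m·σ} < 1, and (ii) the double sum ∑_{p} ∑_{m=2}^{∞} |b(p^m)|·p^{−m·σ}, taken over all primes p with |a(p)| ≤ p^{ε/2} and p ≥ c₀^{2/ε}, is finite. -/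
open Finset

/-- If `‖a p‖ ≤ x` and `‖a (p ^ k)‖ ≤ c * x ^ k`, the alternating convolution of the powers of `a p`
with the values `a (p ^ k)` loses its last two terms, which gives the bound `(m + 1) c x ^ (m + 2)`
at index `m + 2`. -/
lemma norm_alternating_convolution_le {a : ℕ → ℂ} (ha1 : a 1 = 1) {p : ℕ} {c x : ℝ}
    (hx : 0 ≤ x) (hap : ‖a p‖ ≤ x) (ha : ∀ k, ‖a (p ^ k)‖ ≤ c * x ^ k) (m : ℕ) :
    ‖∑ l ∈ Finset.range (m + 2 + 1), (-1 : ℂ) ^ l * (a p) ^ l * a (p ^ (m + 2 - l))‖ ≤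
      ((m : ℝ) + 1) * (c * x ^ (m + 2)) := by
  have hcancel : ∑ l ∈ Finset.range (m + 2 + 1), (-1 : ℂ) ^ l * (a p) ^ l * a (p ^ (m + 2 - l)) =
      ∑ l ∈ Finset.range (m + 1), (-1 : ℂ) ^ l * (a p) ^ l * a (p ^ (m + 2 - l)) := by
    rw [Finset.sum_range_succ, Finset.sum_range_succ, show m + 2 - (m + 1) = 1 by omega]
    simp only [Nat.sub_self, pow_zero, pow_one, ha1]
    ring
  have hterm : ∀ l ∈ Finset.range (m + 1),
      ‖(-1 : ℂ) ^ l * (a p) ^ l * a (p ^ (m + 2 - l))‖ ≤ c * x ^ (m + 2) := by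
    intro l hl
    have hl' : l ≤ m + 2 := by have := Finset.mem_range.1 hl; omega
    calc ‖(-1 : ℂ) ^ l * (a p) ^ l * a (p ^ (m + 2 - l))‖
        = ‖a p‖ ^ l * ‖a (p ^ (m + 2 - l))‖ := by simp
      _ ≤ x ^ l * (c * x ^ (m + 2 - l)) := by
        gcongr
        exact ha _
      _ = c * x ^ (m + 2) := by
        rw [mul_left_comm, ← pow_add, Nat.add_sub_cancel' hl']
  rw [hcancel]
  refine (norm_sum_le_of_le _ hterm).trans_eq ?_
  simp

/-- The series `∑ (m + 1) r ^ (m + 2)` has sum `(r / (1 - r)) ^ 2`. -/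
lemma hasSum_succ_mul_pow_add_two {r : ℝ} (h0 : 0 ≤ r) (h1 : r < 1) :
    HasSum (fun m : ℕ => ((m : ℝ) + 1) * r ^ (m + 2)) ((r / (1 - r)) ^ 2) := by
  have h := hasSum_coe_mul_geometric_of_norm_lt_one (𝕜 := ℝ) (r := r)
    (by rwa [Real.norm_of_nonneg h0])
  rw [← hasSum_nat_add_iff' 1] at h
  have hf : (fun m : ℕ => ((m : ℝ) + 1) * r ^ (m + 2)) =
      fun m : ℕ => r * (((m + 1 : ℕ) : ℝ) * r ^ (m + 1)) := by
    funext m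
    push_cast
    ring
  have hval : (r / (1 - r)) ^ 2 =
      r * (r / (1 - r) ^ 2 - ∑ i ∈ Finset.range 1, (i : ℝ) * r ^ i) := by
    rw [Finset.sum_range_one, Nat.cast_zero, zero_mul, sub_zero, div_pow, sq r, mul_div_assoc]
  rw [hf, hval]
  exact h.mul_left r

/-- A sequence dominated by `c (m + 1) r ^ (m + 2)` with `r ≤ 1 / 3` is summable, with sum at most
`9 / 4 * c * r ^ 2`. -/
lemma summable_and_tsum_le_of_le_succ_mul_pow {f : ℕ → ℝ} {c r : ℝ} (hc : 0 ≤ c) (h0 : 0 ≤ r)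
    (hr : r ≤ 1 / 3) (hf0 : ∀ m, 0 ≤ f m) (hf : ∀ m, f m ≤ c * (((m : ℝ) + 1) * r ^ (m + 2))) :
    Summable f ∧ ∑' m, f m ≤ 9 / 4 * c * r ^ 2 := by
  have hs := (hasSum_succ_mul_pow_add_two h0 (by linarith)).mul_left c
  have hsum : Summable f := Summable.of_nonneg_of_le hf0 hf hs.summable
  refine ⟨hsum, (hasSum_le hf hsum.hasSum hs).trans ?_⟩
  have hq : r / (1 - r) ≤ 3 / 2 * r := by
    rw [div_le_iff₀ (by linarith)]
    nlinarith
  have hq0 : 0 ≤ r / (1 - r) := div_nonneg h0 (by linarith)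
  calc c * (r / (1 - r)) ^ 2 ≤ c * (3 / 2 * r) ^ 2 := by gcongr
    _ = 9 / 4 * c * r ^ 2 := by ring

/-- Convergence bounds for the tails `∑_{m≥2} |b(p^m)|·p^{−mσ}` in the proof of Theorem 1:
for `σ > 1/2 + ε`, each tail is `< 1` and the double sum over the good primes is finite. -/
theorem b_coefficient_tail_bounds
    (ε : ℝ) (hε₀ : 0 < ε) (hε₁ : ε < 1 / 2) (c₀ : ℝ) (hc₀ : 3 ≤ c₀)
    (a : ℕ → ℂ) (ha1 : a 1 = 1)
    (haR : ∀ n : ℕ, 1 ≤ n → ‖a n‖ ≤ c₀ * (n : ℝ) ^ (ε / 2))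
    (b : ℕ → ℕ → ℂ)
    (hb : ∀ p m : ℕ, b p m = ∑ l ∈ Finset.range (m + 1),
      (-1 : ℂ) ^ l * (a p) ^ l * a (p ^ (m - l)))
    (σ : ℝ) (hσ : 1 / 2 + ε < σ) :
    (∀ p : ℕ, Nat.Prime p → ‖a p‖ ≤ (p : ℝ) ^ (ε / 2) → c₀ ^ (2 / ε) ≤ (p : ℝ) →
      (Summable (fun m : ℕ => ‖b p (m + 2)‖ * (p : ℝ) ^ (-(((m : ℝ) + 2)) * σ)) ∧
        ∑' m : ℕ, ‖b p (m + 2)‖ * (p : ℝ) ^ (-(((m : ℝ) + 2)) * σ) < 1)) ∧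
    Summable (fun p : {p : ℕ // Nat.Prime p ∧ ‖a p‖ ≤ (p : ℝ) ^ (ε / 2) ∧
        c₀ ^ (2 / ε) ≤ (p : ℝ)} =>
      ∑' m : ℕ, ‖b (p : ℕ) (m + 2)‖ * ((p : ℕ) : ℝ) ^ (-(((m : ℝ) + 2)) * σ)) := by
  have key : ∀ p : ℕ, Nat.Prime p → ‖a p‖ ≤ (p : ℝ) ^ (ε / 2) → c₀ ^ (2 / ε) ≤ (p : ℝ) →
      (p : ℝ) ^ (-((1 + ε) / 2)) ≤ 1 / c₀ ∧
      Summable (fun m : ℕ => ‖b p (m + 2)‖ * (p : ℝ) ^ (-(((m : ℝ) + 2)) * σ)) ∧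
      ∑' m : ℕ, ‖b p (m + 2)‖ * (p : ℝ) ^ (-(((m : ℝ) + 2)) * σ) ≤
        9 / 4 * c₀ * ((p : ℝ) ^ (-((1 + ε) / 2))) ^ 2 := by
    intro p hp hap hcp
    have hp1 : (1 : ℝ) ≤ p := by exact_mod_cast hp.one_le
    have hp0 : (0 : ℝ) < p := by linarith
    have hcx : c₀ ≤ (p : ℝ) ^ (ε / 2) := by
      calc c₀ = (c₀ ^ (2 / ε)) ^ (ε / 2) := by
            rw [← Real.rpow_mul (by linarith), div_mul_div_cancel₀ hε₀.ne', div_self two_ne_zero,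
              Real.rpow_one]
        _ ≤ (p : ℝ) ^ (ε / 2) := by gcongr
    have hrc : (p : ℝ) ^ (-((1 + ε) / 2)) ≤ 1 / c₀ := by
      rw [Real.rpow_neg hp0.le, ← one_div]
      refine one_div_le_one_div_of_le (by linarith) (hcx.trans ?_)
      exact Real.rpow_le_rpow_of_exponent_le hp1 (by linarith)
    have hr3 : (p : ℝ) ^ (-((1 + ε) / 2)) ≤ 1 / 3 :=
      hrc.trans (one_div_le_one_div_of_le (by norm_num) hc₀)
    refine ⟨hrc, summable_and_tsum_le_of_le_succ_mul_pow (by linarith) (by positivity) hr3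
      (fun m => by positivity) fun m => ?_⟩
    have hpow : ∀ k, ‖a (p ^ k)‖ ≤ c₀ * ((p : ℝ) ^ (ε / 2)) ^ k := by
      intro k
      refine (haR _ (Nat.one_le_pow _ _ hp.pos)).trans_eq ?_
      rw [Nat.cast_pow, Real.rpow_pow_comm hp0.le]
    have hσpow : (p : ℝ) ^ (-((m : ℝ) + 2) * σ) = ((p : ℝ) ^ (-σ)) ^ (m + 2) := by
      rw [← Real.rpow_mul_natCast hp0.le]
      congr 1
      push_cast
      ring
    have hxσ : (p : ℝ) ^ (ε / 2) * (p : ℝ) ^ (-σ) ≤ (p : ℝ) ^ (-((1 + ε) / 2)) := by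
      rw [← Real.rpow_add hp0]
      exact Real.rpow_le_rpow_of_exponent_le hp1 (by linarith)
    rw [hb, hσpow]
    calc _ ≤ ((m : ℝ) + 1) * (c₀ * ((p : ℝ) ^ (ε / 2)) ^ (m + 2)) * ((p : ℝ) ^ (-σ)) ^ (m + 2) := by
          gcongr
          exact norm_alternating_convolution_le ha1 (by positivity) hap hpow m
      _ = c₀ * (((m : ℝ) + 1) * ((p : ℝ) ^ (ε / 2) * (p : ℝ) ^ (-σ)) ^ (m + 2)) := by
          rw [mul_pow]
          ring
      _ ≤ _ := by gcongr
  refine ⟨fun p hp hap hcp => ?_, ?_⟩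
  · obtain ⟨hrc, hsum, hle⟩ := key p hp hap hcp
    refine ⟨hsum, hle.trans_lt ?_⟩
    calc 9 / 4 * c₀ * ((p : ℝ) ^ (-((1 + ε) / 2))) ^ 2 ≤ 9 / 4 * c₀ * (1 / c₀) ^ 2 := by gcongr
      _ = 9 / 4 / c₀ := by field_simp
      _ < 1 := by
        rw [div_lt_one (by linarith)]
        linarith
  · have hmaj : Summable fun n : ℕ => 9 / 4 * c₀ * (n : ℝ) ^ (-(1 + ε)) :=
      (Real.summable_nat_rpow.2 (by linarith)).mul_left _
    refine Summable.of_nonneg_of_le (fun p => tsum_nonneg fun m => by positivity) (fun p => ?_)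
      (hmaj.comp_injective Subtype.val_injective)
    refine (key p p.2.1 p.2.2.1 p.2.2.2).2.2.trans_eq ?_
    rw [← Real.rpow_mul_natCast (Nat.cast_nonneg _), Function.comp_apply]
    congr 2
    push_cast
    ring
end

section
/- Let 1/2 < σ₀ ≤ 1 and 0 < ε < σ₀ − 1/2. Let c : ℕ → ℂ be completely multiplicative with |c(n)| ≤ n^{ε/2} for all n ≥ 1. Suppose the Dirichlet series P(s) = ∑_{n=1}^{∞} c(n)·n^{−s} converges at every s with Re(s) > σ₀ and that there is M > 0 with |P(s)| ≤ M for all s with Re(s) > σ₀. Then for every σ > σ₀ the series ∑_{n=1}^{∞} |c(n)|·n^{−σ} converges. -/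
open Filter Topology Finset

/-- The difference of consecutive terms `m ^ (-w)` is `O(|w| m ^ (-Re w - 1))`. -/
theorem norm_natCast_cpow_sub_le (n : ℕ) {w : ℂ} (hw : 0 < w.re) :
    ‖((n : ℂ) + 1) ^ (-w) - (((n + 1 : ℕ) : ℂ) + 1) ^ (-w)‖
      ≤ ‖w‖ * ((n : ℝ) + 1) ^ (-w.re - 1) := by
  have hpos : (0 : ℝ) < n + 1 := by positivity
  have hw0 : -w ≠ 0 := by
    rw [neg_ne_zero]; rintro rfl; simp at hw
  have key := Convex.norm_image_sub_le_of_norm_hasDerivWithin_le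
    (f := fun y : ℝ => (y : ℂ) ^ (-w)) (f' := fun x : ℝ => -w * (x : ℂ) ^ (-w - 1))
    (s := Set.Icc ((n : ℝ) + 1) (n + 2)) (x := (n : ℝ) + 2) (y := (n : ℝ) + 1)
    (C := ‖w‖ * ((n : ℝ) + 1) ^ (-w.re - 1))
    (fun x hx => (hasDerivAt_ofReal_cpow_const (hpos.trans_le hx.1).ne' hw0).hasDerivWithinAt)
    (fun x hx => by
      rw [norm_mul, norm_neg, Complex.norm_cpow_eq_rpow_re_of_pos (hpos.trans_le hx.1)]
      have hre : (-w - 1).re = -w.re - 1 := by simp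
      rw [hre]
      exact mul_le_mul_of_nonneg_left
        (Real.rpow_le_rpow_of_nonpos hpos hx.1 (by linarith)) (norm_nonneg _))
    (convex_Icc _ _) ⟨by linarith, le_rfl⟩ ⟨le_rfl, by linarith⟩
  have hdist : ‖(n : ℝ) + 1 - (n + 2)‖ = 1 := by norm_num
  rw [hdist, mul_one] at key
  have e₁ : (((n : ℝ) + 1 : ℝ) : ℂ) = n + 1 := by push_cast; rfl
  have e₂ : (((n : ℝ) + 2 : ℝ) : ℂ) = ((n + 1 : ℕ) : ℂ) + 1 := by push_cast; ring
  rwa [e₁, e₂] at key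

/-- Summation by parts. -/
theorem sum_range_mul_eq_abel {R : Type*} [CommRing R] (b g : ℕ → R) (N : ℕ) :
    ∑ n ∈ range N, b n * g n = (∑ k ∈ range N, b k) * g N
      + ∑ n ∈ range N, (∑ k ∈ range (n + 1), b k) * (g n - g (n + 1)) := by
  induction N with
  | zero => simp
  | succ N ih =>
    rw [sum_range_succ, ih, sum_range_succ (fun n => _ * (g n - g (n + 1))) N, sum_range_succ b N]
    ring

theorem norm_natCast_add_one_cpow (n : ℕ) (w : ℂ) :
    ‖((n : ℂ) + 1) ^ w‖ = ((n : ℝ) + 1) ^ w.re := by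
  rw [← Complex.norm_cpow_eq_rpow_re_of_pos (by positivity : (0 : ℝ) < n + 1)]
  push_cast; rfl

theorem summable_natCast_add_one_rpow {r : ℝ} (hr : r < -1) :
    Summable fun n : ℕ => ((n : ℝ) + 1) ^ r := by
  simpa using (summable_nat_add_iff 1).mpr (Real.summable_nat_rpow.mpr hr)

theorem norm_sum_range_mul_cpow_sub_le {b : ℕ → ℂ} {B : ℝ}
    (hB : ∀ N, ‖∑ k ∈ range N, b k‖ ≤ B) {w : ℂ} (hw : 0 < w.re) (n : ℕ) :
    ‖(∑ k ∈ range (n + 1), b k) * (((n : ℂ) + 1) ^ (-w) - (((n + 1 : ℕ) : ℂ) + 1) ^ (-w))‖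
      ≤ B * (‖w‖ * ((n : ℝ) + 1) ^ (-w.re - 1)) := by
  rw [norm_mul]
  exact mul_le_mul (hB _) (norm_natCast_cpow_sub_le n hw) (norm_nonneg _)
    ((norm_nonneg _).trans (hB 0))

/-- A Dirichlet series that converges (perhaps conditionally) on an open half-plane is
holomorphic there. -/
theorem differentiableOn_of_tendsto_dirichlet_sum {a : ℕ → ℂ} {P : ℂ → ℂ} {σ₀ : ℝ}
    (hconv : ∀ s : ℂ, σ₀ < s.re →
      Tendsto (fun N : ℕ => ∑ n ∈ range N, a n * ((n : ℂ) + 1) ^ (-s)) atTop (𝓝 (P s))) :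
    DifferentiableOn ℂ P {s | σ₀ < s.re} := by
  intro s₁ hs₁
  simp only [Set.mem_ofPred_eq] at hs₁
  obtain ⟨x, hx₀, hx₁⟩ := exists_between hs₁
  obtain ⟨y, hxy, hy₁⟩ := exists_between hx₁
  set b : ℕ → ℂ := fun n => a n * ((n : ℂ) + 1) ^ (-(x : ℂ)) with hb
  obtain ⟨B, hB⟩ := (Metric.isBounded_range_of_tendsto _
    (hconv (x : ℂ) (by simpa using hx₀))).exists_norm_le
  replace hB : ∀ N, ‖∑ k ∈ range N, b k‖ ≤ B := fun N => hB _ ⟨N, rfl⟩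
  have hB0 : 0 ≤ B := (norm_nonneg _).trans (hB 0)
  set F : ℕ → ℂ → ℂ := fun n s => (∑ k ∈ range (n + 1), b k) *
    (((n : ℂ) + 1) ^ (-(s - x)) - (((n + 1 : ℕ) : ℂ) + 1) ^ (-(s - x))) with hF
  have hP : ∀ s : ℂ, x < s.re → P s = ∑' n, F n s := by
    intro s hs
    have hw : 0 < (s - x).re := by simpa using hs
    have hsum : Summable fun n => F n s := by
      refine Summable.of_norm_bounded (g := fun n : ℕ =>
        B * (‖s - x‖ * ((n : ℝ) + 1) ^ (-(s - x).re - 1))) ?_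
        (norm_sum_range_mul_cpow_sub_le hB hw)
      exact ((summable_natCast_add_one_rpow (by linarith)).mul_left _).mul_left _
    have hzero : Tendsto (fun N : ℕ => (∑ k ∈ range N, b k) * ((N : ℂ) + 1) ^ (-(s - x)))
        atTop (𝓝 0) := by
      refine squeeze_zero_norm (a := fun N : ℕ => B * ((N : ℝ) + 1) ^ (-(s - x).re))
        (fun N => ?_) ?_
      · rw [norm_mul, norm_natCast_add_one_cpow, Complex.neg_re]
        exact mul_le_mul_of_nonneg_right (hB N) (by positivity)
      · have := ((tendsto_rpow_neg_atTop hw).comp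
          (tendsto_atTop_add_const_right _ 1 tendsto_natCast_atTop_atTop)).const_mul B
        simpa using this
    have hlim := hzero.add hsum.hasSum.tendsto_sum_nat
    rw [zero_add] at hlim
    refine tendsto_nhds_unique (hconv s (hx₀.trans hs)) (hlim.congr fun N => ?_)
    rw [← sum_range_mul_eq_abel b (fun n => ((n : ℂ) + 1) ^ (-(s - x))) N]
    refine sum_congr rfl fun n _ => ?_
    have hn : (n : ℂ) + 1 ≠ 0 := Nat.cast_add_one_ne_zero n
    rw [hb, mul_assoc, ← Complex.cpow_add _ _ hn]
    congr 2; ring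
  set U : Set ℂ := {s | y < s.re} ∩ Metric.ball (x : ℂ) (‖s₁ - x‖ + 1) with hUdef
  have hU : IsOpen U := (isOpen_lt continuous_const Complex.continuous_re).inter Metric.isOpen_ball
  have hs₁U : s₁ ∈ U := ⟨hy₁, by rw [mem_ball_iff_norm]; linarith⟩
  have hdiff : DifferentiableOn ℂ (fun s => ∑' n, F n s) U := by
    refine Complex.differentiableOn_tsum_of_summable_norm
      (u := fun n : ℕ => B * ((‖s₁ - x‖ + 1) * ((n : ℝ) + 1) ^ (-(y - x) - 1)))
      (((summable_natCast_add_one_rpow (by linarith)).mul_left _).mul_left _)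
      (fun n s _ => ?_) hU fun n s hs => ?_
    · have h1 : (n : ℂ) + 1 ≠ 0 := Nat.cast_add_one_ne_zero n
      have h2 : ((n + 1 : ℕ) : ℂ) + 1 ≠ 0 := Nat.cast_add_one_ne_zero (n + 1)
      refine DifferentiableAt.differentiableWithinAt ?_
      refine DifferentiableAt.const_mul (DifferentiableAt.sub ?_ ?_) _
      · exact DifferentiableAt.const_cpow (by fun_prop) (Or.inl h1)
      · exact DifferentiableAt.const_cpow (by fun_prop) (Or.inl h2)
    · have hys : y < s.re := hs.1
      have hre : (s - x).re = s.re - x := by simp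
      refine (norm_sum_range_mul_cpow_sub_le hB (w := s - x) (by linarith) n).trans ?_
      have hball : ‖s - x‖ ≤ ‖s₁ - x‖ + 1 := (mem_ball_iff_norm.mp hs.2).le
      have hn : (1 : ℝ) ≤ n + 1 := by simp
      gcongr
      linarith
  have hPU : DifferentiableOn ℂ P U := hdiff.congr fun s hs => hP s (hxy.trans hs.1)
  exact (hPU.differentiableAt (hU.mem_nhds hs₁U)).differentiableWithinAt

/-- `f` has mean value `m` on the real line: `(2T)⁻¹ ∫_{-T}^{T} f → m`. -/
def HasMean (f : ℝ → ℂ) (m : ℂ) : Prop :=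
  Tendsto (fun T : ℝ => (2 * T : ℂ)⁻¹ * ∫ t in (-T)..T, f t) atTop (𝓝 m)

/-- The oscillation `t ↦ q ^ (i t)`. -/
noncomputable def osc (q t : ℝ) : ℂ := Complex.exp (Real.log q * t * Complex.I)

@[fun_prop]
theorem continuous_osc (q : ℝ) : Continuous (osc q) := by
  unfold osc; fun_prop

theorem osc_mul {p q : ℝ} (hp : p ≠ 0) (hq : q ≠ 0) (t : ℝ) :
    osc (p * q) t = osc p t * osc q t := by
  unfold osc
  rw [← Complex.exp_add, Real.log_mul hp hq]; push_cast; ring_nf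

theorem conj_osc (q t : ℝ) : (starRingEnd ℂ) (osc q t) = osc q⁻¹ t := by
  unfold osc
  rw [← Complex.exp_conj, Real.log_inv]; simp

theorem norm_osc (q t : ℝ) : ‖osc q t‖ = 1 := by
  unfold osc
  rw [← Complex.ofReal_mul, Complex.norm_exp_ofReal_mul_I]

theorem osc_one (t : ℝ) : osc 1 t = 1 := by simp [osc]

theorem HasMean.add {f g : ℝ → ℂ} {a b : ℂ} (hf : HasMean f a) (hg : HasMean g b)
    (hfc : Continuous f) (hgc : Continuous g) : HasMean (fun t => f t + g t) (a + b) := by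
  refine (Tendsto.add hf hg).congr fun T => ?_
  rw [intervalIntegral.integral_add (hfc.intervalIntegrable _ _) (hgc.intervalIntegrable _ _),
    mul_add]

theorem HasMean.const_mul {f : ℝ → ℂ} {a : ℂ} (hf : HasMean f a) (k : ℂ) :
    HasMean (fun t => k * f t) (k * a) := by
  refine (Tendsto.const_mul k hf).congr fun T => ?_
  rw [intervalIntegral.integral_const_mul]; ring

theorem norm_mean_le {f : ℝ → ℂ} {B : ℝ} (hf : ∀ t, ‖f t‖ ≤ B) {T : ℝ} (hT : 0 < T) :
    ‖(2 * T : ℂ)⁻¹ * ∫ t in (-T)..T, f t‖ ≤ B := by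
  have h := intervalIntegral.norm_integral_le_of_norm_le_const (a := -T) (b := T) (f := f)
    (C := B) fun t _ => hf t
  have h2 : |T - -T| = 2 * T := by rw [abs_of_pos] <;> linarith
  have h3 : ‖(2 * T : ℂ)⁻¹‖ = (2 * T)⁻¹ := by
    rw [norm_inv, norm_mul, Complex.norm_real, Real.norm_of_nonneg hT.le]; simp
  rw [norm_mul, h3, inv_mul_le_iff₀ (by linarith)]
  linarith [h2 ▸ h]

theorem HasMean.tsum {f : ℕ → ℝ → ℂ} {m : ℕ → ℂ} {u : ℕ → ℝ} (hu : Summable u)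
    (hf : ∀ n, Continuous (f n)) (hfu : ∀ n t, ‖f n t‖ ≤ u n) (hm : ∀ n, HasMean (f n) (m n)) :
    HasMean (fun t => ∑' n, f n t) (∑' n, m n) := by
  have h := tendsto_tsum_of_dominated_convergence (𝓕 := atTop)
    (f := fun (T : ℝ) n => (2 * T : ℂ)⁻¹ * ∫ t in (-T)..T, f n t) hu hm
    (by filter_upwards [eventually_gt_atTop 0] with T hT n using norm_mean_le (hfu n) hT)
  refine h.congr fun T => ?_
  rw [tsum_mul_left]
  congr 1
  refine (intervalIntegral.hasSum_integral_of_dominated_convergence (fun n _ => u n)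
    (fun n => (hf n).aestronglyMeasurable) (fun n => ?_) ?_ ?_ ?_).tsum_eq
  · exact Eventually.of_forall fun t _ => hfu n t
  · exact Eventually.of_forall fun t _ => hu
  · exact intervalIntegrable_const
  · exact Eventually.of_forall fun t _ =>
      (Summable.of_norm_bounded hu fun n => hfu n t).hasSum

theorem hasMean_osc {q : ℝ} (hq : 0 < q) : HasMean (osc q) (if q = 1 then 1 else 0) := by
  unfold HasMean
  split_ifs with h
  · subst h
    refine tendsto_const_nhds.congr' ?_
    filter_upwards [eventually_gt_atTop 0] with T hT
    have : (T : ℂ) ≠ 0 := by exact_mod_cast hT.ne'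
    simp only [osc_one, intervalIntegral.integral_const, Complex.real_smul]
    push_cast
    field_simp
    ring
  · have hl : Real.log q ≠ 0 := Real.log_ne_zero_of_pos_of_ne_one hq h
    have hc : (Real.log q * Complex.I : ℂ) ≠ 0 :=
      mul_ne_zero (by exact_mod_cast hl) Complex.I_ne_zero
    have hint : ∀ T : ℝ, ∫ t in (-T)..T, osc q t
        = (osc q T - osc q (-T)) / (Real.log q * Complex.I) := by
      intro T
      have := integral_exp_mul_complex (a := -T) (b := T) hc
      simp only [osc]
      convert this using 4 <;> ring_nf
    refine squeeze_zero_norm' (a := fun T : ℝ => T⁻¹ * |Real.log q|⁻¹) ?_ ?_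
    · filter_upwards [eventually_gt_atTop 0] with T hT
      rw [hint, norm_mul, norm_div, norm_mul, norm_inv, norm_mul, Complex.norm_real,
        Complex.norm_real, Complex.norm_I, mul_one, Real.norm_of_nonneg hT.le, Real.norm_eq_abs]
      have h2 : ‖osc q T - osc q (-T)‖ ≤ 2 := (norm_sub_le _ _).trans (by simp [norm_osc]; norm_num)
      have : ‖(2 : ℂ)‖ = 2 := by simp
      rw [this, div_eq_mul_inv, ← mul_assoc]
      gcongr
      rw [mul_inv]
      have := inv_pos.mpr hT
      nlinarith
    · simpa using tendsto_inv_atTop_zero.mul_const (|Real.log q|⁻¹)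

/-- Extension by zero of `g` from the natural numbers to the rationals. -/
noncomputable def ratExtend (g : ℕ → ℂ) (q : ℚ) : ℂ := if q.den = 1 then g q.num.natAbs else 0

theorem ratExtend_natCast (g : ℕ → ℂ) (n : ℕ) : ratExtend g n = g n := by
  simp [ratExtend]

theorem ratExtend_of_forall_ne {g : ℕ → ℂ} {q : ℚ} (hq : 0 ≤ q) (h : ∀ n : ℕ, q ≠ n) :
    ratExtend g q = 0 := by
  rw [ratExtend, if_neg]
  intro hd
  refine h q.num.natAbs ?_
  have hnum : (q.num.natAbs : ℤ) = q.num := Int.natAbs_of_nonneg (Rat.num_nonneg.mpr hq)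
  rw [← Int.cast_natCast (R := ℚ), hnum, Rat.coe_int_num_of_den_eq_one hd]

theorem ratExtend_mul_prime {g : ℕ → ℂ} {p : ℕ} (hp : p.Prime)
    (hg : ∀ m, 1 ≤ m → g (m * p) = g m * g p) {q : ℚ} (hq : 0 < q) (hv : padicValRat p q = 0) :
    ratExtend g (q * p) = ratExtend g q * g p := by
  have := Fact.mk hp
  have hp0 : (p : ℚ) ≠ 0 := by exact_mod_cast hp.ne_zero
  by_cases h : ∃ n : ℕ, q = n
  · obtain ⟨n, rfl⟩ := h
    rw [← Nat.cast_mul, ratExtend_natCast, ratExtend_natCast, hg]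
    exact_mod_cast hq
  · push Not at h
    rw [ratExtend_of_forall_ne hq.le h, zero_mul, ratExtend_of_forall_ne (by positivity)]
    intro m hm
    have h1 : padicValRat p (q * p) = 1 := by
      rw [padicValRat.mul hq.ne' hp0, hv, padicValRat.self hp.one_lt]; rfl
    rw [hm, padicValRat.of_nat] at h1
    obtain ⟨k, rfl⟩ := dvd_of_one_le_padicValNat (p := p) (n := m) (by exact_mod_cast h1.ge)
    refine h k (mul_right_cancel₀ hp0 ?_)
    rw [hm]; push_cast; ring

theorem ratExtend_div_prime {g : ℕ → ℂ} {p : ℕ} (hp : p.Prime)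
    {q : ℚ} (hq : 0 < q) (hv : padicValRat p q = 0) : ratExtend g (q / p) = 0 := by
  have := Fact.mk hp
  have hp0 : (p : ℚ) ≠ 0 := by exact_mod_cast hp.ne_zero
  refine ratExtend_of_forall_ne (by positivity) fun m hm => ?_
  have h1 : padicValRat p (q / p) = -1 := by
    rw [padicValRat.div hq.ne' hp0, hv, padicValRat.self hp.one_lt]; rfl
  rw [hm, padicValRat.of_nat] at h1
  omega

/-- The Riesz product `∏ (1 + Re (u_p p ^ (i t)))`. -/
noncomputable def rieszProd (u : ℕ → ℂ) (S : Finset ℕ) (t : ℝ) : ℝ :=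
  ∏ p ∈ S, (1 + (u p * osc p t).re)

@[fun_prop]
theorem continuous_rieszProd (u : ℕ → ℂ) (S : Finset ℕ) : Continuous (rieszProd u S) := by
  unfold rieszProd; fun_prop

theorem rieszProd_nonneg {u : ℕ → ℂ} (hu : ∀ p, ‖u p‖ ≤ 1) (S : Finset ℕ) (t : ℝ) :
    0 ≤ rieszProd u S t := by
  refine prod_nonneg fun p _ => ?_
  have h := (abs_le.mp (Complex.abs_re_le_norm (u p * osc p t))).1
  rw [norm_mul, norm_osc, mul_one] at h
  linarith [hu p]

/-- Multiplying by a Riesz product over primes multiplies the mean values by an Euler-type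
product. -/
theorem hasMean_mul_rieszProd {f : ℝ → ℂ} (hfc : Continuous f) {g : ℕ → ℂ}
    (hg : ∀ p m : ℕ, p.Prime → 1 ≤ m → g (m * p) = g m * g p)
    (hf : ∀ q : ℚ, 0 < q → HasMean (fun t => f t * osc q t) (ratExtend g q))
    (u : ℕ → ℂ) (S : Finset ℕ) (hS : ∀ p ∈ S, p.Prime) :
    ∀ q : ℚ, 0 < q → (∀ p ∈ S, padicValRat p q = 0) →
      HasMean (fun t => f t * osc q t * rieszProd u S t)
        (ratExtend g q * ∏ p ∈ S, (1 + u p * g p / 2)) := by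
  induction S using Finset.induction_on with
  | empty => intro q hq _; simpa [rieszProd] using hf q hq
  | insert p S hpS ih =>
    intro q hq hv
    have hp : p.Prime := hS p (mem_insert_self p S)
    have := Fact.mk hp
    have hp0 : (p : ℚ) ≠ 0 := by exact_mod_cast hp.ne_zero
    have hp0' : (p : ℝ) ≠ 0 := by exact_mod_cast hp.ne_zero
    have hq0 : (q : ℝ) ≠ 0 := by exact_mod_cast hq.ne'
    have hvS : ∀ r ∈ S, padicValRat r q = 0 := fun r hr => hv r (mem_insert_of_mem hr)
    have hvp : ∀ r ∈ S, padicValRat r (p : ℚ) = 0 := by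
      intro r hr
      have := Fact.mk (hS r (mem_insert_of_mem hr))
      rw [padicValRat.of_nat, padicValNat_primes (by rintro rfl; exact hpS hr)]; rfl
    have ih' := ih fun r hr => hS r (mem_insert_of_mem hr)
    have h1 := ih' q hq hvS
    have h2 := ih' (q * p) (by have := hp.pos; positivity) fun r hr => by
      have := Fact.mk (hS r (mem_insert_of_mem hr))
      rw [padicValRat.mul hq.ne' hp0, hvS r hr, hvp r hr]; rfl
    have h3 := ih' (q / p) (by have := hp.pos; positivity) fun r hr => by
      have := Fact.mk (hS r (mem_insert_of_mem hr))
      rw [padicValRat.div hq.ne' hp0, hvS r hr, hvp r hr]; rfl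
    rw [ratExtend_mul_prime hp (fun m => hg p m hp) hq (hv p (mem_insert_self p S))] at h2
    rw [ratExtend_div_prime hp hq (hv p (mem_insert_self p S))] at h3
    have h := (h1.add (h2.const_mul (u p / 2)) (by fun_prop) (by fun_prop)).add
      (h3.const_mul ((starRingEnd ℂ) (u p) / 2)) (by fun_prop) (by fun_prop)
    convert h using 1
    · ext t
      have hre : (((u p * osc p t).re : ℝ) : ℂ)
          = (u p * osc p t + (starRingEnd ℂ) (u p) * osc (p : ℝ)⁻¹ t) / 2 := by
        rw [Complex.re_eq_add_conj, map_mul, conj_osc]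
      rw [rieszProd, prod_insert hpS, ← rieszProd]
      push_cast
      rw [hre, div_eq_mul_inv (q : ℝ) (p : ℝ), osc_mul hq0 hp0', osc_mul hq0 (inv_ne_zero hp0')]
      ring
    · rw [prod_insert hpS]; ring

/-- Testing a bounded function against nonnegative Riesz products bounds the product of its
coefficients at primes. -/
theorem norm_prod_le_of_forall_hasMean {f : ℝ → ℂ} (hfc : Continuous f) {M : ℝ}
    (hM : ∀ t, ‖f t‖ ≤ M) {g : ℕ → ℂ} (hg1 : g 1 = 1)
    (hg : ∀ p m : ℕ, p.Prime → 1 ≤ m → g (m * p) = g m * g p)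
    (hf : ∀ q : ℚ, 0 < q → HasMean (fun t => f t * osc q t) (ratExtend g q))
    {u : ℕ → ℂ} (hu : ∀ p, ‖u p‖ ≤ 1) (S : Finset ℕ) (hS : ∀ p ∈ S, p.Prime) :
    ‖∏ p ∈ S, (1 + u p * g p / 2)‖ ≤ M := by
  set δ : ℕ → ℂ := fun n => if n = 1 then 1 else 0 with hδ
  have hδf : ∀ q : ℚ, 0 < q → HasMean (fun t => 1 * osc q t) (ratExtend δ q) := by
    intro q hq
    simp only [one_mul]
    convert hasMean_osc (q := (q : ℝ)) (by exact_mod_cast hq) using 1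
    by_cases h : ∃ n : ℕ, q = n
    · obtain ⟨n, rfl⟩ := h
      rw [ratExtend_natCast]; simp [hδ]
    · push Not at h
      rw [ratExtend_of_forall_ne hq.le h, if_neg]
      intro h1
      exact h 1 (by exact_mod_cast h1)
  have hv : ∀ p ∈ S, padicValRat p (1 : ℚ) = 0 := fun p _ => padicValRat.one
  have h1 := hasMean_mul_rieszProd hfc hg hf u S hS 1 one_pos hv
  have h2 := hasMean_mul_rieszProd continuous_const (g := δ) (fun p m hp hm => by
    have : m * p ≠ 1 := fun h => hp.one_lt.ne' (Nat.eq_one_of_mul_eq_one_left h)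
    simp [hδ, hp.ne_one]) hδf u S hS 1 one_pos hv
  have e1 : ratExtend g 1 = 1 := by simpa [hg1] using ratExtend_natCast g 1
  have e2 : ratExtend δ 1 = 1 := by simpa [hδ] using ratExtend_natCast δ 1
  have e3 : ∏ p ∈ S, (1 + u p * δ p / 2) = 1 :=
    prod_eq_one fun p hp => by simp [hδ, (hS p hp).ne_one]
  rw [e1, one_mul] at h1
  rw [e2, e3, one_mul] at h2
  simp only [Rat.cast_one, osc_one, mul_one, one_mul] at h1 h2
  have hlim := (Tendsto.norm h2).const_mul M
  rw [norm_one, mul_one] at hlim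
  refine le_of_tendsto_of_tendsto (Tendsto.norm h1) hlim ?_
  filter_upwards [eventually_gt_atTop 0] with T hT
  have hTT : -T ≤ T := by linarith
  rw [norm_mul, norm_mul, mul_left_comm]
  refine mul_le_mul_of_nonneg_left ?_ (norm_nonneg _)
  have hK0 : 0 ≤ ∫ t in (-T)..T, rieszProd u S t :=
    intervalIntegral.integral_nonneg hTT fun t _ => rieszProd_nonneg hu S t
  rw [intervalIntegral.integral_ofReal, Complex.norm_real, Real.norm_of_nonneg hK0,
    ← intervalIntegral.integral_const_mul]
  refine intervalIntegral.norm_integral_le_of_norm_le hTT (Eventually.of_forall fun t _ => ?_)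
    (Continuous.intervalIntegrable (by fun_prop) _ _)
  rw [norm_mul, Complex.norm_real, Real.norm_of_nonneg (rieszProd_nonneg hu S t)]
  exact mul_le_mul_of_nonneg_right (hM t) (rieszProd_nonneg hu S t)

/-- Moving the line of integration does not change the mean value of a bounded holomorphic
function. -/
theorem HasMean.of_line {G : ℂ → ℂ} {σ σ' B : ℝ} (hσ : σ ≤ σ') {m : ℂ}
    (hG : DifferentiableOn ℂ G {s | σ ≤ s.re})
    (hB : ∀ s : ℂ, σ ≤ s.re → s.re ≤ σ' → ‖G s‖ ≤ B)
    (h : HasMean (fun t => G (σ' + t * Complex.I)) m) :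
    HasMean (fun t => G (σ + t * Complex.I)) m := by
  have hdiff : Tendsto (fun T : ℝ => (2 * T : ℂ)⁻¹ * (∫ t in (-T)..T, G (σ + t * Complex.I)) -
      (2 * T : ℂ)⁻¹ * ∫ t in (-T)..T, G (σ' + t * Complex.I)) atTop (𝓝 0) := by
    refine squeeze_zero_norm' (a := fun T : ℝ => T⁻¹ * (B * (σ' - σ))) ?_
      (by simpa using tendsto_inv_atTop_zero.mul_const (B * (σ' - σ)))
    filter_upwards [eventually_gt_atTop 0] with T hT
    have hrect := Complex.integral_boundary_rect_eq_zero_of_differentiableOn G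
      (σ + (-T : ℝ) * Complex.I) (σ' + T * Complex.I) (hG.mono fun s hs => by
        have h1 := hs.1
        simp only [Set.mem_preimage, Complex.add_re, Complex.ofReal_re, Complex.mul_re,
          Complex.I_re, Complex.I_im, Complex.ofReal_im, mul_zero, mul_one, sub_self,
          add_zero, Set.uIcc_of_le hσ] at h1
        exact h1.1)
    simp only [Complex.add_re, Complex.ofReal_re, Complex.mul_re, Complex.add_im, Complex.mul_im,
      Complex.I_re, Complex.I_im, Complex.ofReal_im, mul_zero, mul_one, sub_self, add_zero,
      zero_add, smul_eq_mul] at hrect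
    have hside : ∀ y : ℝ, ‖∫ x : ℝ in σ..σ', G (x + y * Complex.I)‖ ≤ B * (σ' - σ) := by
      intro y
      have := intervalIntegral.norm_integral_le_of_norm_le_const (a := σ) (b := σ')
        (f := fun x : ℝ => G (x + y * Complex.I)) (C := B) fun x hx => by
          rw [Set.uIoc_of_le hσ] at hx
          exact hB _ (by simpa using hx.1.le) (by simpa using hx.2)
      rwa [abs_of_nonneg (by linarith)] at this
    have heq : (∫ t in (-T)..T, G (σ + t * Complex.I)) - ∫ t in (-T)..T, G (σ' + t * Complex.I)
        = -Complex.I * ((∫ x : ℝ in σ..σ', G (x + (-T : ℝ) * Complex.I))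
          - ∫ x : ℝ in σ..σ', G (x + T * Complex.I)) := by
      linear_combination Complex.I * hrect + ((∫ t in (-T)..T, G (σ + t * Complex.I))
        - ∫ t in (-T)..T, G (σ' + t * Complex.I)) * Complex.I_sq
    have hn : ‖(2 * T : ℂ)⁻¹‖ = (2 * T)⁻¹ := by
      rw [norm_inv, norm_mul, Complex.norm_real, Real.norm_of_nonneg hT.le]; simp
    rw [← mul_sub, heq, norm_mul, norm_mul, norm_neg, Complex.norm_I, one_mul, hn]
    have h2 := (norm_sub_le _ _).trans (add_le_add (hside (-T)) (hside T))
    calc _ ≤ (2 * T)⁻¹ * (B * (σ' - σ) + B * (σ' - σ)) :=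
          mul_le_mul_of_nonneg_left h2 (by positivity)
      _ = _ := by rw [mul_inv]; ring
  have := hdiff.add h
  rw [zero_add] at this
  exact this.congr fun T => by ring

/-- Mean values of `P(s) q ^ s` on a vertical line of absolute convergence. -/
theorem hasMean_dirichlet_of_summable {c : ℕ → ℂ} {σ : ℝ} {P : ℂ → ℂ}
    (hsum : Summable fun n : ℕ => ‖c (n + 1)‖ * ((n : ℝ) + 1) ^ (-σ))
    (hconv : ∀ t : ℝ, Tendsto (fun N : ℕ => ∑ n ∈ range N,
      c (n + 1) * ((n : ℂ) + 1) ^ (-(σ + t * Complex.I))) atTop (𝓝 (P (σ + t * Complex.I))))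
    {q : ℚ} (hq : 0 < q) :
    HasMean (fun t : ℝ => P (σ + t * Complex.I) * Complex.exp (Real.log q * (σ + t * Complex.I)))
      (ratExtend c q) := by
  have hqR : (0 : ℝ) < q := by exact_mod_cast hq
  set k : ℕ → ℂ := fun n =>
    c (n + 1) * (((n : ℝ) + 1) ^ (-σ) * Real.exp (Real.log q * σ) : ℝ) with hk
  have hknorm : ∀ n, ‖k n‖ = ‖c (n + 1)‖ * ((n : ℝ) + 1) ^ (-σ) * Real.exp (Real.log q * σ) := by
    intro n
    rw [hk, norm_mul, Complex.norm_real, Real.norm_of_nonneg (by positivity), mul_assoc]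
  set f : ℕ → ℝ → ℂ := fun n t => k n * osc (q / (n + 1)) t with hf
  have hterm : ∀ (n : ℕ) (t : ℝ), f n t = c (n + 1) * ((n : ℂ) + 1) ^ (-(σ + t * Complex.I)) *
      Complex.exp (Real.log q * (σ + t * Complex.I)) := by
    intro n t
    have hn : (0 : ℝ) < n + 1 := by positivity
    have hnC : (n : ℂ) + 1 ≠ 0 := Nat.cast_add_one_ne_zero n
    have hlog : Complex.log ((n : ℂ) + 1) = (Real.log (n + 1) : ℝ) := by
      rw [Complex.ofReal_log hn.le]; push_cast; rfl
    rw [Complex.cpow_def_of_ne_zero hnC, hlog, mul_assoc, ← Complex.exp_add]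
    simp only [hf, hk, osc]
    rw [Real.rpow_def_of_pos hn, ← Real.exp_add, Complex.ofReal_exp, mul_assoc,
      ← Complex.exp_add, Real.log_div hqR.ne' hn.ne']
    congr 2
    push_cast
    ring
  have hu : Summable fun n => ‖k n‖ := by
    simp only [hknorm]; exact hsum.mul_right _
  have hfu : ∀ n t, ‖f n t‖ ≤ ‖k n‖ := fun n t => by simp [hf, norm_osc]
  have hmean := HasMean.tsum hu (f := f) (fun n => by fun_prop) hfu
    (fun n => (hasMean_osc (q := q / (n + 1)) (by positivity)).const_mul (k n))
  convert hmean using 1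
  · ext t
    have hs : Summable fun n => f n t := Summable.of_norm_bounded hu fun n => hfu n t
    refine tendsto_nhds_unique ((hconv t).mul_const _) (hs.hasSum.tendsto_sum_nat.congr fun N => ?_)
    rw [sum_mul]
    exact sum_congr rfl fun n _ => hterm n t
  · have hne : ∀ n : ℕ, ((q : ℝ) / (n + 1) = 1) ↔ q = ((n + 1 : ℕ) : ℚ) := by
      intro n
      rw [div_eq_one_iff_eq (by positivity)]
      push_cast
      exact_mod_cast Iff.rfl
    simp only [hne]
    by_cases h : ∃ n : ℕ, q = n
    · obtain ⟨n, rfl⟩ := h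
      obtain ⟨m, rfl⟩ : ∃ m, n = m + 1 := Nat.exists_eq_succ_of_ne_zero (by
        rintro rfl; simp at hq)
      rw [ratExtend_natCast, tsum_eq_single m]
      · have hm : (0 : ℝ) < m + 1 := by positivity
        simp only [hk, if_true, mul_one]
        rw [Real.rpow_def_of_pos hm, ← Real.exp_add]
        simp
      · intro b hb
        rw [if_neg, mul_zero]
        intro h
        have : m + 1 = b + 1 := by exact_mod_cast h
        omega
    · push Not at h
      rw [ratExtend_of_forall_ne hq.le h]
      simp only [if_neg (h _), mul_zero, tsum_zero]

/-- A nonnegative completely multiplicative function whose values at primes are at most `3 / 4`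
and have bounded sums is summable. -/
theorem summable_of_sum_primes_le {f : ℕ →* ℝ} (hf0 : ∀ n, 0 ≤ f n)
    (hf : ∀ p : ℕ, p.Prime → f p ≤ 3 / 4) {A : ℝ}
    (hA : ∀ S : Finset ℕ, (∀ p ∈ S, p.Prime) → ∑ p ∈ S, f p ≤ A) :
    Summable fun n : ℕ => f (n + 1) := by
  refine summable_of_sum_range_le (c := Real.exp (4 * A)) (fun n => hf0 _) fun N => ?_
  have hsm := (EulerProduct.summable_and_hasSum_smoothNumbers_prod_primesBelow_geometric (f := f)
    (fun {p} hp => by rw [Real.norm_of_nonneg (hf0 p)]; linarith [hf p hp]) (N + 1)).2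
  have hle : ∑ n ∈ range N, f (n + 1) ≤ ∏ p ∈ (N + 1).primesBelow, (1 - f p)⁻¹ := by
    rw [← hsm.tsum_eq]
    have hinj : Function.Injective fun n : Fin N =>
        (⟨n + 1, Nat.mem_smoothNumbers_of_lt (by omega) (by omega)⟩ : (N + 1).smoothNumbers) := by
      intro a b h
      simp only [Subtype.mk.injEq] at h
      exact Fin.ext (by omega)
    rw [Finset.sum_range fun n => f (n + 1)]
    have := hsm.summable.sum_le_tsum (univ.map ⟨_, hinj⟩) fun i _ => hf0 _
    simpa [sum_map] using this
  refine hle.trans ?_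
  have hprime : ∀ p ∈ (N + 1).primesBelow, p.Prime := fun p hp => Nat.prime_of_mem_primesBelow hp
  calc ∏ p ∈ (N + 1).primesBelow, (1 - f p)⁻¹
      ≤ ∏ p ∈ (N + 1).primesBelow, Real.exp (4 * f p) := by
        refine prod_le_prod (fun p hp => ?_) fun p hp => ?_
        · have := hf p (hprime p hp)
          exact inv_nonneg.mpr (by linarith)
        · have h1 := hf p (hprime p hp)
          have h0 := hf0 p
          refine le_trans ?_ (Real.add_one_le_exp _)
          rw [inv_le_iff_one_le_mul₀ (by linarith)]
          nlinarith
    _ = Real.exp (4 * ∑ p ∈ (N + 1).primesBelow, f p) := by rw [← Real.exp_sum, mul_sum]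
    _ ≤ Real.exp (4 * A) := by
        have := hA _ hprime
        exact Real.exp_le_exp.mpr (by linarith)

theorem one_add_sum_le_prod_one_add {ι : Type*} (S : Finset ι) {x : ι → ℝ} (hx : ∀ i, 0 ≤ x i) :
    1 + ∑ i ∈ S, x i ≤ ∏ i ∈ S, (1 + x i) := by
  classical
  induction S using Finset.induction_on with
  | empty => simp
  | insert i S hi ih =>
    rw [sum_insert hi, prod_insert hi]
    nlinarith [hx i, mul_nonneg (hx i) (sum_nonneg fun j (_ : j ∈ S) => hx j)]

/-- Core step in the proof of Theorem 1: a completely multiplicative Dirichlet series with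
Ramanujan-type coefficients which converges and is bounded in the half-plane `Re(s) > σ₀`
(with `1/2 < σ₀ ≤ 1`, `0 < ε < σ₀ − 1/2`) converges absolutely in that half-plane. -/
theorem bounded_implies_absolutely_convergent
    (σ₀ : ℝ) (hσ₀ : 1 / 2 < σ₀) (hσ₀' : σ₀ ≤ 1)
    (ε : ℝ) (hε₀ : 0 < ε) (hε₁ : ε < σ₀ - 1 / 2)
    (c : ℕ → ℂ) (hc1 : c 1 = 1)
    (hcm : ∀ m n : ℕ, 1 ≤ m → 1 ≤ n → c (m * n) = c m * c n)
    (hcR : ∀ n : ℕ, 1 ≤ n → ‖c n‖ ≤ (n : ℝ) ^ (ε / 2))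
    (P : ℂ → ℂ)
    (hconv : ∀ s : ℂ, σ₀ < s.re →
      Tendsto (fun N : ℕ => ∑ n ∈ Finset.range N, c (n + 1) * ((n : ℂ) + 1) ^ (-s))
        atTop (𝓝 (P s)))
    (M : ℝ) (hM : 0 < M)
    (hbdd : ∀ s : ℂ, σ₀ < s.re → ‖P s‖ ≤ M) :
    ∀ σ : ℝ, σ₀ < σ → Summable (fun n : ℕ => ‖c (n + 1)‖ * ((n : ℝ) + 1) ^ (-σ)) := by
  intro σ hσ
  have hcR' : ∀ (τ : ℝ) (n : ℕ), ‖c (n + 1)‖ * ((n : ℝ) + 1) ^ (-τ)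
      ≤ ((n : ℝ) + 1) ^ (ε / 2 - τ) := by
    intro τ n
    have h := hcR (n + 1) (by omega)
    push_cast at h
    rw [sub_eq_add_neg, Real.rpow_add (by positivity)]
    gcongr
  have habs : ∀ τ : ℝ, 2 < τ → Summable fun n : ℕ => ‖c (n + 1)‖ * ((n : ℝ) + 1) ^ (-τ) :=
    fun τ hτ => Summable.of_nonneg_of_le (fun n => by positivity) (hcR' τ)
      (summable_natCast_add_one_rpow (by linarith))
  have hhol : DifferentiableOn ℂ P {s | σ₀ < s.re} :=
    differentiableOn_of_tendsto_dirichlet_sum hconv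
  have hline : ∀ (τ t : ℝ), σ₀ < τ → σ₀ < ((τ : ℂ) + t * Complex.I).re := fun τ t h => by simpa
  set g : ℕ → ℂ := fun n => c n * Real.exp (-(Real.log n * σ)) with hg
  have hgm : ∀ m n : ℕ, 1 ≤ m → 1 ≤ n → g (m * n) = g m * g n := by
    intro m n hm hn
    have hm' : (m : ℝ) ≠ 0 := by positivity
    have hn' : (n : ℝ) ≠ 0 := by positivity
    simp only [hg]
    rw [hcm m n hm hn, Nat.cast_mul, Real.log_mul hm' hn', add_mul, neg_add, Real.exp_add]
    push_cast
    ring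
  have hgnorm : ∀ n : ℕ, ‖g (n + 1)‖ = ‖c (n + 1)‖ * ((n : ℝ) + 1) ^ (-σ) := by
    intro n
    rw [hg, norm_mul, Complex.norm_real, Real.norm_of_nonneg (Real.exp_nonneg _),
      Real.rpow_def_of_pos (by positivity)]
    push_cast
    rw [mul_neg]
  have hmean : ∀ q : ℚ, 0 < q →
      HasMean (fun t => P (σ + t * Complex.I) * osc q t) (ratExtend g q) := by
    intro q hq
    have hfar := hasMean_dirichlet_of_summable (habs (σ + 2) (by linarith))
      (fun t => hconv _ (hline (σ + 2) t (by linarith))) hq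
    have hnear := HasMean.of_line (G := fun s => P s * Complex.exp (Real.log q * s)) (σ := σ)
      (σ' := σ + 2) (B := M * Real.exp (|Real.log q| * (σ + 2))) (by linarith)
      ((hhol.mono fun s hs => hσ.trans_le hs).mul (by fun_prop))
      (fun s hs hs' => by
        rw [norm_mul, Complex.norm_exp]
        refine mul_le_mul (hbdd s (hσ.trans_le hs)) (Real.exp_le_exp.mpr ?_)
          (Real.exp_nonneg _) hM.le
        rw [Complex.re_ofReal_mul]
        exact mul_le_mul (le_abs_self _) hs' (by linarith) (abs_nonneg _)) hfar
    convert hnear.const_mul (Real.exp (-(Real.log q * σ)) : ℝ) using 1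
    · ext t
      rw [mul_left_comm, Complex.ofReal_exp, ← Complex.exp_add, osc]
      congr 2
      push_cast
      ring
    · by_cases h : ∃ n : ℕ, q = n
      · obtain ⟨n, rfl⟩ := h
        rw [ratExtend_natCast, ratExtend_natCast, hg, mul_comm, Rat.cast_natCast]
      · push Not at h
        rw [ratExtend_of_forall_ne hq.le h, ratExtend_of_forall_ne hq.le h, mul_zero]
  have hcont : Continuous fun t : ℝ => P (σ + t * Complex.I) :=
    hhol.continuousOn.comp_continuous (by fun_prop) fun t => hline σ t hσ
  have hg1 : g 1 = 1 := by simp [hg, hc1]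
  let f : ℕ →* ℝ :=
    { toFun := fun n => if n = 0 then 0 else ‖g n‖
      map_one' := by simp [hg1]
      map_mul' := fun m n => by
        rcases Nat.eq_zero_or_pos m with rfl | hm
        · simp
        rcases Nat.eq_zero_or_pos n with rfl | hn
        · simp
        simp [hgm m n hm hn, hm.ne', hn.ne'] }
  have hf : ∀ n : ℕ, n ≠ 0 → f n = ‖g n‖ := fun n hn => if_neg hn
  have hf0 : ∀ n, 0 ≤ f n := fun n => by
    rcases eq_or_ne n 0 with rfl | hn
    · simp [f]
    · rw [hf n hn]; exact norm_nonneg _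
  have hphase : ∀ n, (starRingEnd ℂ (g n) / ‖g n‖) * g n = ‖g n‖ := by
    intro n
    rcases eq_or_ne (g n) 0 with h | h
    · simp [h]
    · have : (‖g n‖ : ℂ) ≠ 0 := by exact_mod_cast norm_ne_zero_iff.mpr h
      rw [div_mul_eq_mul_div, Complex.conj_mul', div_eq_iff this, sq]
  refine (summable_of_sum_primes_le hf0 (A := 2 * M) (fun p hp => ?_) fun S hS => ?_).congr
    fun n => by rw [hf _ n.succ_ne_zero, hgnorm]
  · obtain ⟨n, rfl⟩ : ∃ n, p = n + 1 := Nat.exists_eq_succ_of_ne_zero hp.ne_zero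
    rw [hf _ n.succ_ne_zero, hgnorm]
    have hn : (2 : ℝ) ≤ n + 1 := by exact_mod_cast hp.two_le
    calc _ ≤ ((n : ℝ) + 1) ^ (ε / 2 - σ) := hcR' σ n
      _ ≤ ((n : ℝ) + 1) ^ (-(1 / 2) : ℝ) :=
        Real.rpow_le_rpow_of_exponent_le (by linarith) (by linarith)
      _ ≤ 2 ^ (-(1 / 2) : ℝ) := Real.rpow_le_rpow_of_nonpos (by norm_num) hn (by norm_num)
      _ ≤ 3 / 4 := by
        rw [Real.rpow_neg (by norm_num), ← Real.sqrt_eq_rpow,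
          inv_le_comm₀ (by positivity) (by norm_num)]
        exact Real.le_sqrt_of_sq_le (by norm_num)
  · have hprod := norm_prod_le_of_forall_hasMean hcont (fun t => hbdd _ (hline σ t hσ)) hg1
      (fun p m hp hm => hgm m p hm hp.one_le) hmean
      (u := fun n => starRingEnd ℂ (g n) / ‖g n‖) (fun n => by
        rw [norm_div, Complex.norm_real, norm_norm, Complex.norm_conj]
        exact div_self_le_one _) S hS
    have hreal : ∏ p ∈ S, (1 + starRingEnd ℂ (g p) / ‖g p‖ * g p / 2)
        = ((∏ p ∈ S, (1 + f p / 2) : ℝ) : ℂ) := by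
      push_cast
      exact prod_congr rfl fun p hp => by rw [hphase, hf p (hS p hp).ne_zero]
    rw [hreal, Complex.norm_real] at hprod
    have h1 := (le_abs_self _).trans hprod
    have h2 : 1 + ∑ p ∈ S, f p / 2 ≤ ∏ p ∈ S, (1 + f p / 2) :=
      one_add_sum_le_prod_one_add S fun p => div_nonneg (hf0 p) zero_le_two
    rw [← sum_div] at h2
    linarith
end

section
/- Let σ₀ ∈ ℝ and c : ℕ → ℂ be such that the Dirichlet series D(s) = ∑_{n=1}^{∞} c(n)·n^{−s} converges at every s with Re(s) > σ₀, and suppose there is M > 0 with |D(s)| ≤ M for all s with Re(s) > σ₀. Then for every σ > σ₀ there exists C > 0 such that for all t ∈ ℝ and all Y ≥ 1, |∑_{n=1}^{∞} c(n)·n^{−σ−it}·e^{−n/Y}| ≤ C. -/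
open Filter Topology Finset Complex

/-- The function `e⁻ˣ - 1`, whose Mellin transform on `-1 < Re s < 0` is the Gamma function. -/
noncomputable def expNegSubOne (x : ℝ) : ℂ := (Real.exp (-x) : ℂ) - 1

theorem continuous_expNegSubOne : Continuous expNegSubOne := by
  unfold expNegSubOne; fun_prop

theorem hasDerivAt_expNegSubOne (x : ℝ) :
    HasDerivAt expNegSubOne (-(Real.exp (-x) : ℂ)) x := by
  have h : HasDerivAt (fun x : ℝ => Real.exp (-x)) (-Real.exp (-x)) x := by
    simpa using (hasDerivAt_neg x).exp
  have h' : HasDerivAt expNegSubOne ((-Real.exp (-x) : ℝ) : ℂ) x := h.ofReal_comp.sub_const 1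
  rwa [ofReal_neg] at h'

theorem norm_expNegSubOne_le_one {x : ℝ} (hx : 0 ≤ x) : ‖expNegSubOne x‖ ≤ 1 := by
  have h : expNegSubOne x = ((Real.exp (-x) - 1 : ℝ) : ℂ) := by simp [expNegSubOne]
  have h1 : Real.exp (-x) ≤ 1 := Real.exp_le_one_iff.mpr (by linarith)
  rw [h, norm_real, Real.norm_eq_abs, abs_le]
  constructor <;> linarith [Real.exp_pos (-x)]

theorem norm_expNegSubOne_le {x : ℝ} (hx : 0 ≤ x) : ‖expNegSubOne x‖ ≤ x := by
  have h : expNegSubOne x = ((Real.exp (-x) - 1 : ℝ) : ℂ) := by simp [expNegSubOne]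
  have h1 : Real.exp (-x) ≤ 1 := Real.exp_le_one_iff.mpr (by linarith)
  rw [h, norm_real, Real.norm_eq_abs, abs_le]
  constructor <;> linarith [Real.add_one_le_exp (-x)]

theorem mellinConvergent_expNegSubOne {s : ℂ} (h1 : -1 < s.re) (h0 : s.re < 0) :
    MellinConvergent expNegSubOne s := by
  refine mellinConvergent_of_isBigO_rpow (a := 0) (b := -1)
    (continuous_expNegSubOne.locallyIntegrable.locallyIntegrableOn _) ?_ h0 ?_ h1
  · refine Asymptotics.IsBigO.of_bound 1 ?_
    filter_upwards [eventually_ge_atTop 0] with x hx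
    simpa using norm_expNegSubOne_le_one hx
  · refine Asymptotics.IsBigO.of_bound 1 ?_
    filter_upwards [self_mem_nhdsWithin] with x hx
    have hx' : (0 : ℝ) < x := hx
    simpa [abs_of_pos hx'] using norm_expNegSubOne_le hx'.le

theorem mellin_expNegSubOne {s : ℂ} (h1 : -1 < s.re) (h0 : s.re < 0) :
    mellin expNegSubOne s = Gamma s := by
  have hs : s ≠ 0 := by rintro rfl; simp at h0
  have hs1 : 0 < (s + 1).re := by simp; linarith
  have hG := GammaIntegral_convergent hs1
  simp only [add_sub_cancel_right] at hG
  have hv : ∀ x ∈ Set.Ioi (0 : ℝ),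
      HasDerivAt (fun x : ℝ => (x : ℂ) ^ s / s) ((x : ℂ) ^ (s - 1)) x := by
    intro x hx
    have := hasDerivAt_ofReal_cpow_const' (r := s - 1) (ne_of_gt hx) (by
      intro h; apply hs; linear_combination h)
    simpa using this
  have hnorm : ∀ x : ℝ, 0 < x → ‖(x : ℂ) ^ s / s‖ = x ^ s.re / ‖s‖ := by
    intro x hx
    rw [norm_div, norm_cpow_eq_rpow_re_of_pos hx]
  have key := MeasureTheory.integral_Ioi_mul_deriv_eq_deriv_mul (a := (0 : ℝ))
    (u := expNegSubOne) (u' := fun x => -(Real.exp (-x) : ℂ))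
    (v := fun x : ℝ => (x : ℂ) ^ s / s) (v' := fun x : ℝ => (x : ℂ) ^ (s - 1))
    (a' := 0) (b' := 0)
    (fun x _ => hasDerivAt_expNegSubOne x) hv
    (by
      refine (mellinConvergent_expNegSubOne h1 h0).congr_fun (fun x _ => ?_) measurableSet_Ioi
      simp [mul_comm])
    (by
      have hG' : MeasureTheory.IntegrableOn
          (fun x : ℝ => (Real.exp (-x) : ℂ) * (x : ℂ) ^ s * (-1 / s)) (Set.Ioi 0) :=
        hG.mul_const _
      refine hG'.congr_fun (fun x _ => ?_) measurableSet_Ioi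
      simp only [Pi.mul_apply]; ring)
    (by
      rw [tendsto_zero_iff_norm_tendsto_zero]
      have hlim : Tendsto (fun x : ℝ => x ^ (s.re + 1) / ‖s‖) (𝓝[>] 0) (𝓝 0) := by
        have := ((Real.continuousAt_rpow_const 0 (s.re + 1) (Or.inr (by linarith))).tendsto.mono_left
          (nhdsWithin_le_nhds (s := Set.Ioi (0 : ℝ)))).div_const ‖s‖
        rwa [Real.zero_rpow (by linarith), zero_div] at this
      refine squeeze_zero' (Eventually.of_forall fun _ => norm_nonneg _) ?_ hlim
      filter_upwards [self_mem_nhdsWithin] with x hx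
      have hx' : (0 : ℝ) < x := hx
      rw [Pi.mul_apply, norm_mul, hnorm x hx', Real.rpow_add_one hx'.ne', mul_comm (x ^ s.re) x,
        mul_div_assoc]
      gcongr
      exact norm_expNegSubOne_le hx'.le)
    (by
      rw [tendsto_zero_iff_norm_tendsto_zero]
      have hlim : Tendsto (fun x : ℝ => x ^ s.re / ‖s‖) atTop (𝓝 0) := by
        have := (tendsto_rpow_neg_atTop (y := -s.re) (by linarith)).div_const ‖s‖
        simpa using this
      refine squeeze_zero' (Eventually.of_forall fun _ => norm_nonneg _) ?_ hlim
      filter_upwards [eventually_gt_atTop 0] with x hx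
      rw [Pi.mul_apply, norm_mul, hnorm x hx]
      exact mul_le_of_le_one_left (by positivity) (norm_expNegSubOne_le_one hx.le))
  have hint : ∫ x : ℝ in Set.Ioi 0, -(Real.exp (-x) : ℂ) * ((x : ℂ) ^ s / s)
      = -(GammaIntegral (s + 1) / s) := by
    rw [GammaIntegral, ← MeasureTheory.integral_div, ← MeasureTheory.integral_neg]
    congr 1 with x
    rw [add_sub_cancel_right]; ring
  rw [hint, ← Gamma_eq_integral hs1, Gamma_add_one s hs, mul_div_cancel_left₀ _ hs] at key
  simpa [mellin, mul_comm] using key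

theorem norm_Gamma_le_Gamma_re {s : ℂ} (hs : 0 < s.re) : ‖Gamma s‖ ≤ Real.Gamma s.re := by
  rw [Gamma_eq_integral hs, Real.Gamma_eq_integral hs, GammaIntegral]
  refine (MeasureTheory.norm_integral_le_integral_norm _).trans_eq ?_
  refine MeasureTheory.setIntegral_congr_fun measurableSet_Ioi fun x hx => ?_
  simp only [norm_mul, norm_real, Real.norm_eq_abs, Real.abs_exp]
  rw [norm_cpow_eq_rpow_re_of_pos hx]; simp

/-- Decay of the Gamma function on vertical lines of abscissa `-δ` with `0 < δ ≤ 1 / 2`. -/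
theorem norm_mul_norm_Gamma_le {δ : ℝ} (hδ : 0 < δ) (hδ' : δ ≤ 1 / 2) (u : ℝ) :
    ‖((-δ : ℝ) : ℂ) + u * I‖ * ‖Gamma (((-δ : ℝ) : ℂ) + u * I)‖
      ≤ 4 * Real.Gamma (3 - δ) * (1 + u ^ 2)⁻¹ := by
  set w : ℂ := ((-δ : ℝ) : ℂ) + u * I with hw
  have hre : w.re = -δ := by simp [hw]
  have him : w.im = u := by simp [hw]
  have hne : ∀ r : ℝ, r - δ ≠ 0 → w + r ≠ 0 := by
    intro r hr h
    have := congrArg re h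
    simp only [add_re, hre, ofReal_re, zero_re] at this
    exact hr (by linarith)
  have h0 : w ≠ 0 := by simpa using hne 0 (by linarith)
  have h1 : w + 1 ≠ 0 := by simpa using hne 1 (by linarith)
  have h2 : w + 1 + 1 ≠ 0 := by
    have := hne 2 (by linarith)
    rwa [show w + 1 + 1 = w + (2 : ℝ) by push_cast; ring]
  have hG : Gamma (w + 1 + 1 + 1) = (w + 1 + 1) * ((w + 1) * (w * Gamma w)) := by
    rw [Gamma_add_one _ h2, Gamma_add_one _ h1, Gamma_add_one _ h0]
  have hle : ‖Gamma (w + 1 + 1 + 1)‖ ≤ Real.Gamma (3 - δ) := by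
    have hr : (w + 1 + 1 + 1).re = 3 - δ := by simp [hre]; ring
    rw [← hr]
    exact norm_Gamma_le_Gamma_re (by rw [hr]; linarith)
  have hsq : (1 + u ^ 2) / 4 ≤ ‖w + 1‖ ^ 2 := by
    rw [← normSq_eq_norm_sq, normSq_apply]
    simp only [add_re, add_im, hre, him, one_re, one_im]
    nlinarith [sq_nonneg u]
  have hmono : ‖w + 1‖ ≤ ‖w + 1 + 1‖ := by
    rw [← sq_le_sq₀ (norm_nonneg _) (norm_nonneg _)]
    rw [← normSq_eq_norm_sq, ← normSq_eq_norm_sq, normSq_apply, normSq_apply]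
    simp only [add_re, add_im, hre, him, one_re, one_im]
    nlinarith
  rw [hG, norm_mul, norm_mul, norm_mul] at hle
  have hpos : 0 ≤ ‖w‖ * ‖Gamma w‖ := by positivity
  have hchain : (1 + u ^ 2) / 4 * (‖w‖ * ‖Gamma w‖) ≤ Real.Gamma (3 - δ) := by
    refine le_trans ?_ hle
    rw [← mul_assoc ‖w + 1 + 1‖]
    refine mul_le_mul_of_nonneg_right ?_ hpos
    nlinarith [norm_nonneg (w + 1)]
  rw [← div_eq_mul_inv, le_div_iff₀ (by positivity)]
  linarith

theorem continuous_Gamma_vertical {δ : ℝ} (hδ : 0 < δ) (hδ' : δ < 1) :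
    Continuous fun u : ℝ => Gamma (((-δ : ℝ) : ℂ) + u * I) := by
  refine continuous_iff_continuousAt.mpr fun u => ?_
  refine ContinuousAt.comp (g := Gamma) (f := fun u : ℝ => ((-δ : ℝ) : ℂ) + u * I) ?_ (by fun_prop)
  refine (differentiableAt_Gamma _ fun m h => ?_).continuousAt
  have := congrArg re h
  simp only [add_re, ofReal_re, mul_re, I_re, I_im, ofReal_im, neg_re, natCast_re] at this
  have hm : (m : ℝ) = δ := by linarith
  have h1 : 0 < m := by exact_mod_cast hm ▸ hδ
  have h2 : m < 1 := by exact_mod_cast hm ▸ hδ'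
  omega

theorem norm_Gamma_vertical_le {δ : ℝ} (hδ : 0 < δ) (hδ' : δ ≤ 1 / 2) (u : ℝ) :
    ‖Gamma (((-δ : ℝ) : ℂ) + u * I)‖ ≤ 4 * Real.Gamma (3 - δ) / δ * (1 + u ^ 2)⁻¹ := by
  have h := norm_mul_norm_Gamma_le hδ hδ' u
  have hw : δ ≤ ‖((-δ : ℝ) : ℂ) + u * I‖ := by
    simpa [abs_of_pos hδ] using abs_re_le_norm (((-δ : ℝ) : ℂ) + u * I)
  rw [div_mul_eq_mul_div, le_div_iff₀ hδ, mul_comm]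
  exact (mul_le_mul_of_nonneg_right hw (norm_nonneg _)).trans h

theorem integrable_Gamma_vertical {δ : ℝ} (hδ : 0 < δ) (hδ' : δ ≤ 1 / 2) :
    MeasureTheory.Integrable fun u : ℝ => Gamma (((-δ : ℝ) : ℂ) + u * I) :=
  (integrable_inv_one_add_sq.const_mul (4 * Real.Gamma (3 - δ) / δ)).mono'
    (continuous_Gamma_vertical hδ (by linarith)).aestronglyMeasurable
    (Eventually.of_forall (norm_Gamma_vertical_le hδ hδ'))

theorem expNegSubOne_eq_integral {δ : ℝ} (hδ : 0 < δ) (hδ' : δ ≤ 1 / 2) {x : ℝ} (hx : 0 < x) :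
    expNegSubOne x = ((1 / (2 * Real.pi) : ℝ) : ℂ) *
      ∫ u : ℝ, (x : ℂ) ^ (-(((-δ : ℝ) : ℂ) + u * I)) * Gamma (((-δ : ℝ) : ℂ) + u * I) := by
  have hmel : ∀ u : ℝ, mellin expNegSubOne (((-δ : ℝ) : ℂ) + u * I)
      = Gamma (((-δ : ℝ) : ℂ) + u * I) := fun u =>
    mellin_expNegSubOne (by simp; linarith) (by simp; linarith)
  have h := mellinInv_mellin_eq (-δ) expNegSubOne hx
    (mellinConvergent_expNegSubOne (by simp; linarith) (by simp; linarith))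
    (by
      have := integrable_Gamma_vertical hδ hδ'
      simp_rw [← hmel] at this
      exact this)
    continuous_expNegSubOne.continuousAt
  simp_rw [mellinInv, hmel] at h
  rw [← h, real_smul]
  rfl

theorem sum_range_mul_eq_by_parts (a b : ℕ → ℂ) (N : ℕ) :
    ∑ n ∈ range N, a n * b n = (∑ n ∈ range N, a n) * b N +
      ∑ n ∈ range N, (∑ k ∈ range (n + 1), a k) * (b n - b (n + 1)) := by
  induction N with
  | zero => simp
  | succ N ih =>
    rw [sum_range_succ, ih, sum_range_succ (fun n => _ * (b n - b (n + 1))), sum_range_succ a]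
    ring

theorem norm_cpow_neg_sub_cpow_neg_le {z : ℂ} (hz : 0 < z.re) {x y : ℝ} (hx : 0 < x)
    (hxy : x ≤ y) :
    ‖(x : ℂ) ^ (-z) - (y : ℂ) ^ (-z)‖ ≤ ‖z‖ / z.re * (x ^ (-z.re) - y ^ (-z.re)) := by
  have hz0 : z ≠ 0 := by rintro rfl; simp at hz
  have h0 : (0 : ℝ) ∉ Set.uIcc x y := by
    rw [Set.uIcc_of_le hxy]; exact fun h => absurd h.1 (not_le.mpr hx)
  have hC : ∫ v : ℝ in x..y, (v : ℂ) ^ (-z - 1) = ((x : ℂ) ^ (-z) - (y : ℂ) ^ (-z)) / z := by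
    rw [integral_cpow (Or.inr ⟨by simpa using hz0, h0⟩), sub_add_cancel, div_neg, ← neg_div,
      neg_sub]
  have hR : ∫ v : ℝ in x..y, v ^ (-z.re - 1) = (x ^ (-z.re) - y ^ (-z.re)) / z.re := by
    rw [integral_rpow (Or.inr ⟨by simpa using hz.ne', h0⟩), sub_add_cancel, div_neg, ← neg_div,
      neg_sub]
  have hle : ‖∫ v : ℝ in x..y, (v : ℂ) ^ (-z - 1)‖ ≤ ∫ v : ℝ in x..y, v ^ (-z.re - 1) := by
    refine (intervalIntegral.norm_integral_le_integral_norm hxy).trans_eq ?_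
    refine intervalIntegral.integral_congr fun v hv => ?_
    rw [Set.uIcc_of_le hxy] at hv
    rw [norm_cpow_eq_rpow_re_of_pos (hx.trans_le hv.1)]
    simp
  rw [hC, hR, norm_div, div_le_iff₀ (norm_pos_iff.mpr hz0)] at hle
  exact hle.trans_eq (by ring)

/-- Partial sums of a Dirichlet series are bounded by a multiple of `1 + ‖z‖ / Re z` in the half
plane `Re z > 0` as soon as they are bounded at `0`. -/
theorem norm_sum_range_mul_cpow_neg_le {a : ℕ → ℂ} {B : ℝ}
    (hB : ∀ N, ‖∑ n ∈ range N, a n‖ ≤ B) {z : ℂ} (hz : 0 < z.re) (N : ℕ) :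
    ‖∑ n ∈ range N, a n * ((n : ℂ) + 1) ^ (-z)‖ ≤ B * (1 + ‖z‖ / z.re) := by
  have hB0 : 0 ≤ B := (norm_nonneg _).trans (hB 0)
  set β : ℕ → ℝ := fun n => ((n : ℝ) + 1) ^ (-z.re) with hβ
  have hβ0 : ∀ n, 0 ≤ β n := fun n => by positivity
  have hβ1 : ∀ n, β n ≤ 1 := fun n =>
    Real.rpow_le_one_of_one_le_of_nonpos (by simp) (by linarith)
  have hdiff : ∀ n : ℕ, ‖((n : ℂ) + 1) ^ (-z) - (((n + 1 : ℕ) : ℂ) + 1) ^ (-z)‖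
      ≤ ‖z‖ / z.re * (β n - β (n + 1)) := by
    intro n
    have := norm_cpow_neg_sub_cpow_neg_le hz (x := (n : ℝ) + 1) (y := ((n + 1 : ℕ) : ℝ) + 1)
      (by positivity) (by push_cast; linarith)
    simpa [hβ] using this
  have hnorm : ‖((N : ℂ) + 1) ^ (-z)‖ ≤ 1 := by
    have h := norm_cpow_eq_rpow_re_of_pos (x := (N : ℝ) + 1) (by positivity) (-z)
    push_cast at h
    rw [h]
    exact hβ1 N
  rw [sum_range_mul_eq_by_parts]
  calc _ ≤ ‖(∑ n ∈ range N, a n) * ((N : ℂ) + 1) ^ (-z)‖ + ∑ n ∈ range N,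
        ‖(∑ k ∈ range (n + 1), a k) *
          (((n : ℂ) + 1) ^ (-z) - (((n + 1 : ℕ) : ℂ) + 1) ^ (-z))‖ :=
        (norm_add_le _ _).trans (by gcongr; exact norm_sum_le _ _)
    _ ≤ B * 1 + ∑ n ∈ range N, B * (‖z‖ / z.re * (β n - β (n + 1))) := by
        simp only [norm_mul]
        gcongr with n
        · exact hB N
        · exact hB _
        · exact hdiff n
    _ = B * (1 + ‖z‖ / z.re * (β 0 - β N)) := by
        rw [← mul_sum, ← mul_sum, sum_range_sub']; ring
    _ ≤ B * (1 + ‖z‖ / z.re) := by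
        gcongr
        exact mul_le_of_le_one_right (by positivity) (by linarith [hβ0 N, hβ1 0])

theorem cpow_neg_mul_expNegSubOne_eq_integral {δ : ℝ} (hδ : 0 < δ) (hδ' : δ ≤ 1 / 2) (s : ℂ)
    {x Y : ℝ} (hx : 0 < x) (hY : 0 < Y) :
    (x : ℂ) ^ (-s) * expNegSubOne (x / Y) = ((1 / (2 * Real.pi) : ℝ) : ℂ) *
      ∫ u : ℝ, (Y : ℂ) ^ (((-δ : ℝ) : ℂ) + u * I) * Gamma (((-δ : ℝ) : ℂ) + u * I) *
        (x : ℂ) ^ (-(s + (((-δ : ℝ) : ℂ) + u * I))) := by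
  rw [expNegSubOne_eq_integral hδ hδ' (div_pos hx hY), mul_left_comm,
    ← MeasureTheory.integral_const_mul]
  congr 2 with u
  generalize ((-δ : ℝ) : ℂ) + u * I = w
  have hxC : (x : ℂ) ≠ 0 := ofReal_ne_zero.mpr hx.ne'
  rw [ofReal_div, div_eq_mul_inv, ← ofReal_inv,
    mul_cpow_ofReal_nonneg hx.le (inv_nonneg.mpr hY.le), neg_add s w, cpow_add _ _ hxC, ofReal_inv,
    inv_cpow _ _ (by rw [arg_ofReal_of_nonneg hY.le]; exact Real.pi_pos.ne), cpow_neg (Y : ℂ),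
    inv_inv]
  ring

theorem norm_cpow_vertical_le_one {δ : ℝ} (hδ : 0 ≤ δ) {Y : ℝ} (hY : 1 ≤ Y) (u : ℝ) :
    ‖(Y : ℂ) ^ (((-δ : ℝ) : ℂ) + u * I)‖ ≤ 1 := by
  rw [norm_cpow_eq_rpow_re_of_pos (by linarith)]
  exact Real.rpow_le_one_of_one_le_of_nonpos hY (by simpa using hδ)

theorem integrable_cpow_mul_Gamma_mul_cpow {δ : ℝ} (hδ : 0 < δ) (hδ' : δ ≤ 1 / 2) (s : ℂ)
    {x Y : ℝ} (hx : 0 < x) (hY : 1 ≤ Y) :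
    MeasureTheory.Integrable fun u : ℝ =>
      (Y : ℂ) ^ (((-δ : ℝ) : ℂ) + u * I) * Gamma (((-δ : ℝ) : ℂ) + u * I) *
        (x : ℂ) ^ (-(s + (((-δ : ℝ) : ℂ) + u * I))) := by
  have hYC : (Y : ℂ) ≠ 0 := ofReal_ne_zero.mpr (by linarith)
  have hxC : (x : ℂ) ≠ 0 := ofReal_ne_zero.mpr hx.ne'
  have hYc : Continuous fun u : ℝ => (Y : ℂ) ^ (((-δ : ℝ) : ℂ) + u * I) :=
    Continuous.const_cpow (by fun_prop) (Or.inl hYC)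
  have hxc : Continuous fun u : ℝ => (x : ℂ) ^ (-(s + (((-δ : ℝ) : ℂ) + u * I))) :=
    Continuous.const_cpow (by fun_prop) (Or.inl hxC)
  refine ((integrable_Gamma_vertical hδ hδ').bdd_mul hYc.aestronglyMeasurable
    (Eventually.of_forall (norm_cpow_vertical_le_one hδ.le hY))).mul_bdd
    (c := x ^ (-(s.re - δ))) hxc.aestronglyMeasurable (Eventually.of_forall fun u => ?_)
  rw [norm_cpow_eq_rpow_re_of_pos hx]
  simp [sub_eq_add_neg]

/-- The uniform bound on the exponentially smoothed Dirichlet series obtained in the proof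
of Theorem 1 by a Mellin transform and contour shift: if `D(s) = ∑ c(n)·n^{−s}` converges
and is bounded by `M` for `Re(s) > σ₀`, then for every `σ > σ₀` the smoothed sums
`∑ c(n)·n^{−σ−it}·e^{−n/Y}` are bounded uniformly in `t ∈ ℝ` and `Y ≥ 1`. -/
theorem smoothed_dirichlet_series_uniformly_bounded
    (σ₀ : ℝ) (c : ℕ → ℂ) (D : ℂ → ℂ)
    (hconv : ∀ s : ℂ, σ₀ < s.re →
      Tendsto (fun N : ℕ => ∑ n ∈ Finset.range N, c (n + 1) * ((n : ℂ) + 1) ^ (-s))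
        atTop (𝓝 (D s)))
    (M : ℝ) (hM : 0 < M)
    (hbdd : ∀ s : ℂ, σ₀ < s.re → ‖D s‖ ≤ M) :
    ∀ σ : ℝ, σ₀ < σ → ∃ C : ℝ, 0 < C ∧ ∀ t : ℝ, ∀ Y : ℝ, 1 ≤ Y →
      ‖∑' n : ℕ, c (n + 1) * ((n : ℂ) + 1) ^ (-((σ : ℂ) + Complex.I * t)) *
        Real.exp (-((n : ℝ) + 1) / Y)‖ ≤ C := by
  intro σ hσ
  obtain ⟨δ, hδ, hδ', hδσ⟩ : ∃ δ : ℝ, 0 < δ ∧ δ ≤ 1 / 2 ∧ σ₀ < σ - 2 * δ :=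
    ⟨min (1 / 2) ((σ - σ₀) / 3), lt_min (by norm_num) (by linarith), min_le_left _ _, by
      linarith [min_le_right (1 / 2) ((σ - σ₀) / 3)]⟩
  set K : ℝ := 4 * Real.Gamma (3 - δ) / δ
  have hK0 : 0 ≤ K := by
    have := Real.Gamma_pos_of_pos (show 0 < 3 - δ by linarith)
    positivity
  set J : ℝ := ∫ u : ℝ, K * (1 + u ^ 2)⁻¹ * M
  have hJ0 : 0 ≤ J := MeasureTheory.integral_nonneg fun u => by positivity
  refine ⟨M + 1 / (2 * Real.pi) * J, by positivity, fun t Y hY => ?_⟩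
  have hY0 : 0 < Y := by linarith
  by_cases hsum : Summable fun n : ℕ => c (n + 1) *
      ((n : ℂ) + 1) ^ (-((σ : ℂ) + Complex.I * t)) * Real.exp (-((n : ℝ) + 1) / Y)
  swap
  · rw [tsum_eq_zero_of_not_summable hsum, norm_zero]
    positivity
  set s : ℂ := (σ : ℂ) + Complex.I * t with hs
  have hsre : s.re = σ := by simp [hs]
  let w : ℝ → ℂ := fun u => ((-δ : ℝ) : ℂ) + u * I
  have hwre : ∀ u, (w u).re = -δ := fun u => by simp [w]
  let G : ℝ → ℂ := fun u => (Y : ℂ) ^ w u * Gamma (w u)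
  let P : ℕ → ℝ → ℂ := fun N u =>
    ∑ n ∈ range N, c (n + 1) * ((n : ℂ) + 1) ^ (-(s + w u))
  have hG : ∀ u, ‖G u‖ ≤ K * (1 + u ^ 2)⁻¹ := fun u => by
    rw [norm_mul]
    exact (mul_le_of_le_one_left (norm_nonneg _) (norm_cpow_vertical_le_one hδ.le hY u)).trans
      (norm_Gamma_vertical_le hδ hδ' u)
  have hint : ∀ n : ℕ, MeasureTheory.Integrable fun u : ℝ =>
      G u * (c (n + 1) * ((n : ℂ) + 1) ^ (-(s + w u))) := fun n => by
    have h := (integrable_cpow_mul_Gamma_mul_cpow hδ hδ' s (x := (n : ℝ) + 1)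
      (by positivity) hY).const_mul (c (n + 1))
    refine h.congr (Eventually.of_forall fun u => ?_)
    simp only [G, w]
    push_cast
    ring
  have hpartial : ∀ N : ℕ, ∑ n ∈ range N, c (n + 1) * ((n : ℂ) + 1) ^ (-s) *
      Real.exp (-((n : ℝ) + 1) / Y) = ∑ n ∈ range N, c (n + 1) * ((n : ℂ) + 1) ^ (-s) +
        ((1 / (2 * Real.pi) : ℝ) : ℂ) * ∫ u, G u * P N u := by
    intro N
    simp only [P, mul_sum]
    rw [MeasureTheory.integral_finsetSum _ fun n _ => hint n, mul_sum, ← sum_add_distrib]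
    refine sum_congr rfl fun n _ => ?_
    have h := cpow_neg_mul_expNegSubOne_eq_integral hδ hδ' s (x := (n : ℝ) + 1)
      (by positivity) hY0
    have h' : ∫ u, G u * (c (n + 1) * ((n : ℂ) + 1) ^ (-(s + w u))) = c (n + 1) *
        ∫ u : ℝ, (Y : ℂ) ^ (((-δ : ℝ) : ℂ) + u * I) * Gamma (((-δ : ℝ) : ℂ) + u * I) *
          (((n : ℝ) + 1 : ℝ) : ℂ) ^ (-(s + (((-δ : ℝ) : ℂ) + u * I))) := by
      rw [← MeasureTheory.integral_const_mul]
      congr 1 with u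
      simp only [G, w]
      push_cast
      ring
    rw [h', mul_left_comm, ← h, expNegSubOne, neg_div]
    push_cast
    ring
  obtain ⟨B, hB⟩ : ∃ B, ∀ N, ‖∑ n ∈ range N, c (n + 1) * ((n : ℂ) + 1) ^ (-(s - 2 * δ))‖ ≤ B := by
    have hlim := hconv (s - 2 * δ) (by simpa [hsre] using hδσ)
    obtain ⟨B, hB⟩ := (Metric.isBounded_range_of_tendsto _ hlim).exists_norm_le
    exact ⟨B, fun N => hB _ ⟨N, rfl⟩⟩
  have hB0 : 0 ≤ B := (norm_nonneg _).trans (hB 0)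
  have hP : ∀ N u, ‖P N u‖ ≤ 2 * B / δ * ‖w u‖ := by
    intro N u
    set z : ℂ := w u + 2 * δ with hz
    have hzre : z.re = δ := by simp [hz, hwre]; ring
    have hzn : ‖z‖ = ‖w u‖ := by
      rw [norm_def, norm_def, normSq_apply, normSq_apply, hzre, hwre]
      simp [hz]
    have hwδ : δ ≤ ‖w u‖ := by
      have := abs_re_le_norm (w u)
      rwa [hwre, abs_neg, abs_of_pos hδ] at this
    have h := norm_sum_range_mul_cpow_neg_le hB (z := z) (by rwa [hzre]) N
    have heq : ∑ n ∈ range N, c (n + 1) * ((n : ℂ) + 1) ^ (-(s - 2 * δ)) * ((n : ℂ) + 1) ^ (-z)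
        = P N u := by
      refine sum_congr rfl fun n _ => ?_
      rw [mul_assoc, ← cpow_add _ _ (Nat.cast_add_one_ne_zero n)]
      congr 2
      rw [hz]; ring
    rw [heq, hzre, hzn] at h
    have h1 : 1 ≤ ‖w u‖ / δ := (one_le_div hδ).mpr hwδ
    calc ‖P N u‖ ≤ B * (1 + ‖w u‖ / δ) := h
      _ ≤ B * (‖w u‖ / δ + ‖w u‖ / δ) := by gcongr
      _ = 2 * B / δ * ‖w u‖ := by ring
  have hlimInt : Tendsto (fun N => ∫ u, G u * P N u) atTop (𝓝 (∫ u, G u * D (s + w u))) := by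
    refine MeasureTheory.tendsto_integral_of_dominated_convergence
      (fun u => 2 * B / δ * (4 * Real.Gamma (3 - δ) * (1 + u ^ 2)⁻¹)) (fun N => ?_)
      (integrable_inv_one_add_sq.const_mul _ |>.const_mul _)
      (fun N => Eventually.of_forall fun u => ?_) (Eventually.of_forall fun u => ?_)
    · simp only [P, mul_sum]
      exact (MeasureTheory.integrable_finsetSum _ fun n _ => hint n).aestronglyMeasurable
    · calc ‖G u * P N u‖ = ‖(Y : ℂ) ^ w u‖ * (‖Gamma (w u)‖ * ‖P N u‖) := by
            simp only [G, norm_mul]; ring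
        _ ≤ 1 * (‖Gamma (w u)‖ * (2 * B / δ * ‖w u‖)) := by
            gcongr
            · exact norm_cpow_vertical_le_one hδ.le hY u
            · exact hP N u
        _ = 2 * B / δ * (‖w u‖ * ‖Gamma (w u)‖) := by ring
        _ ≤ _ := by
            exact mul_le_mul_of_nonneg_left (norm_mul_norm_Gamma_le hδ hδ' u) (by positivity)
    · exact (hconv (s + w u) (by rw [add_re, hsre, hwre]; linarith)).const_mul _
  have hlim := (hconv s (by rwa [hsre])).add
    (hlimInt.const_mul ((1 / (2 * Real.pi) : ℝ) : ℂ))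
  simp only [← hpartial] at hlim
  rw [tendsto_nhds_unique hsum.hasSum.tendsto_sum_nat hlim]
  have hfinal : ‖∫ u, G u * D (s + w u)‖ ≤ J := by
    refine MeasureTheory.norm_integral_le_of_norm_le
      ((integrable_inv_one_add_sq.const_mul K).mul_const M) (Eventually.of_forall fun u => ?_)
    rw [norm_mul]
    gcongr
    · exact hG u
    · exact hbdd _ (by rw [add_re, hsre, hwre]; linarith)
  refine (norm_add_le _ _).trans (add_le_add (hbdd s (by rwa [hsre])) ?_)
  rw [norm_mul, norm_real, Real.norm_of_nonneg (by positivity)]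
  gcongr
end

section
/- Let c : ℕ → ℂ be completely multiplicative, N ≥ 1 an integer, and w : ℕ → ℝ with w(n) ≥ 0 for all n. Then sup_{t ∈ ℝ} |∑_{n=1}^{N} w(n)·c(n)·n^{−it}| = ∑_{n=1}^{N} w(n)·|c(n)|. -/
open Finset

/-- A coefficient of a generalised trigonometric polynomial is bounded by its sup norm, stated for
the constant term: if all the `f i` are nonzero, then the constant term is bounded. -/
lemma norm_constant_term_le {ι : Type*} (s : Finset ι) (f : ι → ℝ) (hf : ∀ i ∈ s, f i ≠ 0)
    (a : ℂ) (b : ι → ℂ) (B : ℝ)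
    (h : ∀ t : ℝ, ‖a + ∑ i ∈ s, b i * Complex.exp (Complex.I * t * f i)‖ ≤ B) : ‖a‖ ≤ B := by
  classical
  induction s using Finset.induction_on generalizing b with
  | empty => simpa using h 0
  | insert j s hj ih =>
    have hfj : f j ≠ 0 := hf j (mem_insert_self j s)
    -- averaging over the shift by `π / f j` annihilates the frequency `f j`
    refine ih (fun i hi => hf i (mem_insert_of_mem hi))
      (fun i => b i * ((1 + Complex.exp (Complex.I * (Real.pi / f j : ℝ) * f i)) / 2))
      fun t => ?_
    have hsplit : ∀ i, Complex.exp (Complex.I * (t + Real.pi / f j : ℝ) * f i) =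
        Complex.exp (Complex.I * t * f i) *
          Complex.exp (Complex.I * (Real.pi / f j : ℝ) * f i) := by
      intro i
      rw [← Complex.exp_add]
      congr 1
      push_cast
      ring
    have hkill : Complex.exp (Complex.I * (Real.pi / f j : ℝ) * f j) = -1 := by
      rw [← Complex.exp_pi_mul_I]
      congr 1
      have : (f j : ℂ) ≠ 0 := by exact_mod_cast hfj
      push_cast
      field_simp
    have h₀ := h t
    have h₁ := h (t + Real.pi / f j)
    rw [sum_insert hj] at h₀ h₁
    simp only [hsplit] at h₁
    rw [hkill] at h₁
    set X := b j * Complex.exp (Complex.I * t * f j) with hX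
    have key : a + ∑ i ∈ s, b i *
          ((1 + Complex.exp (Complex.I * (Real.pi / f j : ℝ) * f i)) / 2) *
            Complex.exp (Complex.I * t * f i) =
        ((a + (X + ∑ i ∈ s, b i * Complex.exp (Complex.I * t * f i))) +
          (a + (b j * (Complex.exp (Complex.I * t * f j) * -1) +
            ∑ i ∈ s, b i * (Complex.exp (Complex.I * t * f i) *
              Complex.exp (Complex.I * (Real.pi / f j : ℝ) * f i))))) / 2 := by
      have : ∑ i ∈ s, b i *
          ((1 + Complex.exp (Complex.I * (Real.pi / f j : ℝ) * f i)) / 2) *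
            Complex.exp (Complex.I * t * f i) =
          (∑ i ∈ s, b i * Complex.exp (Complex.I * t * f i) +
            ∑ i ∈ s, b i * (Complex.exp (Complex.I * t * f i) *
              Complex.exp (Complex.I * (Real.pi / f j : ℝ) * f i))) / 2 := by
        rw [← sum_add_distrib, sum_div]
        exact sum_congr rfl fun i _ => by ring
      rw [this, hX]
      ring
    rw [key, norm_div, Complex.norm_ofNat]
    linarith [norm_add_le (a + (X + ∑ i ∈ s, b i * Complex.exp (Complex.I * t * f i)))
      (a + (b j * (Complex.exp (Complex.I * t * f j) * -1) +
            ∑ i ∈ s, b i * (Complex.exp (Complex.I * t * f i) *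
              Complex.exp (Complex.I * (Real.pi / f j : ℝ) * f i))))]

/-- The coefficients of a Dirichlet polynomial are bounded by its supremum on a vertical line. -/
lemma norm_dirichlet_coeff_le (s : Finset ℕ) (hs : ∀ n ∈ s, 1 ≤ n) (b : ℕ → ℂ) (B : ℝ)
    (h : ∀ t : ℝ, ‖∑ n ∈ s, b n * Complex.exp (-Complex.I * t * Real.log n)‖ ≤ B)
    {m : ℕ} (hm : m ∈ s) : ‖b m‖ ≤ B := by
  have hm0 : (0 : ℝ) < m := by exact_mod_cast hs m hm
  refine norm_constant_term_le (s.erase m) (fun n => Real.log m - Real.log n) ?_ _ b B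
    fun t => ?_
  · intro n hn heq
    have hn0 : (0 : ℝ) < n := by exact_mod_cast hs n (mem_of_mem_erase hn)
    have := Real.log_injOn_pos hm0 hn0 (sub_eq_zero.mp heq)
    exact ne_of_mem_erase hn (by exact_mod_cast this.symm)
  · have hrot : b m + ∑ n ∈ s.erase m,
          b n * Complex.exp (Complex.I * t * (Real.log m - Real.log n : ℝ)) =
        Complex.exp ((t * Real.log m : ℝ) * Complex.I) *
          ∑ n ∈ s, b n * Complex.exp (-Complex.I * t * Real.log n) := by
      rw [mul_sum, ← add_sum_erase s _ hm]
      have hterm : ∀ n, Complex.exp ((t * Real.log m : ℝ) * Complex.I) *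
          (b n * Complex.exp (-Complex.I * t * Real.log n)) =
          b n * Complex.exp (Complex.I * t * (Real.log m - Real.log n : ℝ)) := by
        intro n
        rw [mul_left_comm, ← Complex.exp_add]
        congr 2
        push_cast
        ring
      simp only [hterm, sub_self, Complex.ofReal_zero, mul_zero, Complex.exp_zero, mul_one]
    rw [hrot, norm_mul, Complex.norm_exp_ofReal_mul_I, one_mul]
    exact h t

/-- The set of products of `q` elements of `s`. -/
def productSet (s : Finset ℕ) (q : ℕ) : Finset ℕ :=
  (Fintype.piFinset fun _ : Fin q => s).image fun p => ∏ i, p i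

/-- The coefficient at `m` of the `q`-th Dirichlet convolution power of `w` restricted to `s`. -/
def convPow (w : ℕ → ℝ) (s : Finset ℕ) (q m : ℕ) : ℝ :=
  ∑ p ∈ Fintype.piFinset (fun _ : Fin q => s) with ∏ i, p i = m, ∏ i, w (p i)

lemma convPow_nonneg {w : ℕ → ℝ} (hw : ∀ n, 0 ≤ w n) (s : Finset ℕ) (q m : ℕ) :
    0 ≤ convPow w s q m :=
  sum_nonneg fun _ _ => prod_nonneg fun _ _ => hw _

lemma one_le_of_mem_productSet {s : Finset ℕ} (hs : ∀ n ∈ s, 1 ≤ n) {q m : ℕ}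
    (hm : m ∈ productSet s q) : 1 ≤ m := by
  obtain ⟨p, hp, rfl⟩ := mem_image.mp hm
  rw [Fintype.mem_piFinset] at hp
  exact Nat.succ_le_of_lt (prod_pos fun i _ => hs _ (hp i))

/-- The number of products of `q` elements of `s` grows polynomially in `q`. -/
lemma card_productSet_le (s : Finset ℕ) (q : ℕ) : #(productSet s q) ≤ (q + 1) ^ #s := by
  have hsub : productSet s q ⊆
      (Fintype.piFinset fun _ : s => range (q + 1)).image fun k => ∏ n : s, (n : ℕ) ^ k n := by
    intro m hm
    obtain ⟨p, hp, rfl⟩ := mem_image.mp hm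
    rw [Fintype.mem_piFinset] at hp
    refine mem_image.mpr ⟨fun n => #{i | p i = n}, ?_, ?_⟩
    · rw [Fintype.mem_piFinset]
      intro n
      rw [mem_range, Nat.lt_succ_iff]
      exact (card_le_univ _).trans_eq (Fintype.card_fin q)
    · rw [prod_coe_sort s (fun n => n ^ #{i | p i = n}),
        ← prod_fiberwise_of_maps_to (t := s) fun i _ => hp i]
      refine prod_congr rfl fun n _ => ?_
      rw [prod_congr rfl fun i hi => (mem_filter.mp hi).2, prod_const]
  refine (card_le_card hsub).trans (card_image_le.trans_eq ?_)
  simp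

/-- Expansion of powers of a weighted sum of a completely multiplicative function. -/
lemma sum_smul_pow {R : Type*} [CommRing R] [Algebra ℝ R] (d : ℕ → R) (hd1 : d 1 = 1)
    (hd : ∀ m n : ℕ, 1 ≤ m → 1 ≤ n → d (m * n) = d m * d n)
    (w : ℕ → ℝ) (s : Finset ℕ) (hs : ∀ n ∈ s, 1 ≤ n) (q : ℕ) :
    (∑ n ∈ s, w n • d n) ^ q = ∑ m ∈ productSet s q, convPow w s q m • d m := by
  have hprod : ∀ p : Fin q → ℕ, (∀ i, 1 ≤ p i) → ∏ i, d (p i) = d (∏ i, p i) := by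
    intro p hp
    have : ∀ u : Finset (Fin q), ∏ i ∈ u, d (p i) = d (∏ i ∈ u, p i) := by
      intro u
      induction u using Finset.induction_on with
      | empty => simp [hd1]
      | insert j u hj ih =>
        rw [prod_insert hj, prod_insert hj, ih,
          hd _ _ (hp j) (Nat.succ_le_of_lt (prod_pos fun i _ => hp i))]
    exact this univ
  rw [sum_pow', ← sum_fiberwise_of_maps_to (t := productSet s q)
    (g := fun p : Fin q → ℕ => ∏ i, p i) fun p hp => mem_image_of_mem _ hp]
  refine sum_congr rfl fun m _ => ?_
  rw [convPow, sum_smul]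
  refine sum_congr rfl fun p hp => ?_
  obtain ⟨hps, rfl⟩ := mem_filter.mp hp
  rw [Fintype.mem_piFinset] at hps
  rw [prod_smul, hprod p fun i => hs _ (hps i)]

lemma le_of_forall_pow_le_polynomial_mul_pow {S M : ℝ} (hM : 0 ≤ M) (k : ℕ)
    (h : ∀ q : ℕ, S ^ q ≤ ((q : ℝ) + 1) ^ k * M ^ q) : S ≤ M := by
  by_contra! hlt
  have hS : 0 < S := hM.trans_lt hlt
  have hr0 : 0 ≤ M / S := by positivity
  have hr1 : M / S < 1 := (div_lt_one hS).mpr hlt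
  have hlim := (tendsto_pow_const_mul_const_pow_of_abs_lt_one k
    (by rwa [abs_of_nonneg hr0])).comp (Filter.tendsto_add_atTop_nat 1)
  have hle : M / S ≤ 0 := by
    refine ge_of_tendsto' hlim fun q => ?_
    have hq : 1 ≤ ((q : ℝ) + 1) ^ k * (M / S) ^ q := by
      rw [div_pow, mul_div_assoc', le_div_iff₀ (by positivity), one_mul]
      exact h q
    calc M / S = 1 * (M / S) := (one_mul _).symm
      _ ≤ ((q : ℝ) + 1) ^ k * (M / S) ^ q * (M / S) := by gcongr
      _ = _ := by simp [pow_succ, mul_assoc]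
  have hM0 : M = 0 := by
    have : M / S = 0 := le_antisymm hle hr0
    simpa [hS.ne'] using this
  have := h 1
  simp only [hM0, pow_one, mul_zero] at this
  exact this.not_gt hS

/-- Phase alignment via Kronecker's theorem: for completely multiplicative `c : ℕ → ℂ` and
nonnegative weights `w`, `sup_{t ∈ ℝ} |∑_{n=1}^N w(n)·c(n)·n^{−it}| = ∑_{n=1}^N w(n)·|c(n)|`. -/
theorem sup_weighted_twisted_sum_eq
    (c : ℕ → ℂ) (hc1 : c 1 = 1)
    (hcm : ∀ m n : ℕ, 1 ≤ m → 1 ≤ n → c (m * n) = c m * c n)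
    (N : ℕ) (hN : 1 ≤ N) (w : ℕ → ℝ) (hw : ∀ n, 0 ≤ w n) :
    (⨆ t : ℝ, ‖∑ n ∈ Finset.Icc 1 N,
        (w n : ℂ) * c n * Complex.exp (-Complex.I * t * Real.log n)‖) =
      ∑ n ∈ Finset.Icc 1 N, w n * ‖c n‖ := by
  have hs : ∀ n ∈ Icc 1 N, 1 ≤ n := fun n hn => (mem_Icc.mp hn).1
  have hle : ∀ t : ℝ, ‖∑ n ∈ Finset.Icc 1 N,
      (w n : ℂ) * c n * Complex.exp (-Complex.I * t * Real.log n)‖ ≤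
      ∑ n ∈ Finset.Icc 1 N, w n * ‖c n‖ := by
    intro t
    refine norm_sum_le_of_le _ fun n _ => ?_
    have : -Complex.I * t * Real.log n = (-(t * Real.log n) : ℝ) * Complex.I := by
      push_cast
      ring
    rw [this, norm_mul, norm_mul, Complex.norm_exp_ofReal_mul_I, mul_one, Complex.norm_real,
      Real.norm_of_nonneg (hw n)]
  refine le_antisymm (ciSup_le hle) ?_
  have hbdd : BddAbove (Set.range fun t : ℝ => ‖∑ n ∈ Finset.Icc 1 N,
      (w n : ℂ) * c n * Complex.exp (-Complex.I * t * Real.log n)‖) :=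
    ⟨_, Set.forall_mem_range.mpr hle⟩
  set M := ⨆ t : ℝ, ‖∑ n ∈ Finset.Icc 1 N,
      (w n : ℂ) * c n * Complex.exp (-Complex.I * t * Real.log n)‖
  have hM : 0 ≤ M := Real.iSup_nonneg fun t => norm_nonneg _
  refine le_of_forall_pow_le_polynomial_mul_pow hM N fun q => ?_
  have hpow : ∀ t : ℝ, ‖∑ m ∈ productSet (Icc 1 N) q, (convPow w (Icc 1 N) q m : ℂ) * c m *
      Complex.exp (-Complex.I * t * Real.log m)‖ ≤ M ^ q := by
    intro t
    have hexpand := sum_smul_pow (fun n => c n * Complex.exp (-Complex.I * t * Real.log n))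
      (by simp [hc1]) (fun m n hm hn => by
        have hm0 : (m : ℝ) ≠ 0 := by positivity
        have hn0 : (n : ℝ) ≠ 0 := by positivity
        rw [hcm m n hm hn, Nat.cast_mul, Real.log_mul hm0 hn0, Complex.ofReal_add, mul_add,
          Complex.exp_add]
        ring) w (Icc 1 N) hs q
    simp only [Complex.real_smul, ← mul_assoc] at hexpand
    rw [← hexpand, norm_pow]
    exact pow_le_pow_left₀ (norm_nonneg _) (le_ciSup hbdd t) q
  have hcoeff : ∀ m ∈ productSet (Icc 1 N) q, convPow w (Icc 1 N) q m * ‖c m‖ ≤ M ^ q := by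
    intro m hm
    have := norm_dirichlet_coeff_le _ (fun _ => one_le_of_mem_productSet hs)
      (fun m => (convPow w (Icc 1 N) q m : ℂ) * c m) _ hpow hm
    rwa [norm_mul, Complex.norm_real, Real.norm_of_nonneg (convPow_nonneg hw _ _ _)] at this
  have hexpand := sum_smul_pow (fun n => ‖c n‖) (by simp [hc1])
    (fun m n hm hn => by rw [hcm m n hm hn, norm_mul]) w (Icc 1 N) hs q
  simp only [smul_eq_mul] at hexpand
  have hcard : (#(productSet (Icc 1 N) q) : ℝ) ≤ ((q : ℝ) + 1) ^ N := by
    have := card_productSet_le (Icc 1 N) q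
    rw [Nat.card_Icc, Nat.add_sub_cancel] at this
    exact_mod_cast this
  calc _ = _ := hexpand
    _ ≤ #(productSet (Icc 1 N) q) • M ^ q := sum_le_card_nsmul _ _ _ hcoeff
    _ ≤ ((q : ℝ) + 1) ^ N * M ^ q := by
      rw [nsmul_eq_mul]
      gcongr
end

section
/- Let P be a finite set of prime numbers and let a, b : P → ℂ. Then sup_{t ∈ ℝ} ∏_{p ∈ P} |1 + a(p)·p^{−it} + b(p)·p^{−2it}| ≥ ∏_{p ∈ P} (1 + (1/24)·(|a(p)| + |b(p)|)). -/
open Finset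

open MeasureTheory BoundedContinuousFunction UnitAddTorus Complex

theorem UnitAddTorus.measure_ext_of_integral_mFourier_eq {d : Type*} [Fintype d]
    {μ ν : Measure (UnitAddTorus d)} [IsFiniteMeasure μ] [IsFiniteMeasure ν]
    (h : ∀ n : d → ℤ, ∫ x, mFourier n x ∂μ = ∫ x, mFourier n x ∂ν) : μ = ν := by
  refine ext_of_forall_mem_subalgebra_integral_eq_of_polish (𝕜 := ℂ)
    (A := (mFourierSubalgebra d).comap (toContinuousMapStarₐ ℂ)) ?_ ?_
  · intro x y hxy
    obtain ⟨_, ⟨f, hf, rfl⟩, hne⟩ := mFourierSubalgebra_separatesPoints hxy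
    exact ⟨_, ⟨f, ⟨mkOfCompact f, hf, rfl⟩, rfl⟩, hne⟩
  · intro g hg
    have hmem : g.toContinuousMap ∈ Submodule.span ℂ (Set.range (mFourier (d := d))) := by
      rw [← mFourierSubalgebra_coe]
      exact hg
    have hint (f : C(UnitAddTorus d, ℂ)) (ρ : Measure (UnitAddTorus d)) [IsFiniteMeasure ρ] :
        Integrable f ρ :=
      f.continuous.integrable_of_hasCompactSupport (HasCompactSupport.of_compactSpace f)
    refine Submodule.span_induction
      (p := fun (f : C(UnitAddTorus d, ℂ)) _ ↦ ∫ x, f x ∂μ = ∫ x, f x ∂ν)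
      ?_ ?_ ?_ ?_ hmem
    · rintro _ ⟨n, rfl⟩
      exact h n
    · simp
    · intro f₁ f₂ _ _ h₁ h₂
      simp only [ContinuousMap.add_apply]
      rw [integral_add (hint f₁ μ) (hint f₂ μ), integral_add (hint f₁ ν) (hint f₂ ν), h₁, h₂]
    · intro c f _ hf
      simp only [ContinuousMap.smul_apply, integral_smul, hf]

theorem UnitAddTorus.mFourier_apply_add {d : Type*} [Fintype d] (n : d → ℤ)
    (x y : UnitAddTorus d) : mFourier n (x + y) = mFourier n x * mFourier n y := by
  simp [mFourier, fourier_apply, AddCircle.toCircle_add, Finset.prod_mul_distrib]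

theorem UnitAddTorus.integral_mFourier_comp_eq_zero {d G : Type*} [Fintype d] [AddGroup G]
    [MeasurableSpace G] [MeasurableAdd G] {μ : Measure G} [μ.IsAddLeftInvariant]
    (φ : G →+ UnitAddTorus d) {n : d → ℤ} {g : G} (hg : mFourier n (φ g) ≠ 1) :
    ∫ x, mFourier n (φ x) ∂μ = 0 := by
  have h := integral_add_left_eq_self (μ := μ) (fun x ↦ mFourier n (φ x)) g
  simp only [map_add, mFourier_apply_add, integral_const_mul] at h
  exact (mul_left_eq_self₀.mp h).resolve_left hg

/-- A subgroup of the torus on which no nontrivial character is trivial is dense. -/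
theorem UnitAddTorus.dense_of_mFourier_ne_one {d : Type*} [Fintype d]
    (H : AddSubgroup (UnitAddTorus d))
    (hH : ∀ n : d → ℤ, n ≠ 0 → ∃ x ∈ H, mFourier n x ≠ 1) :
    Dense (H : Set (UnitAddTorus d)) := by
  let K := H.topologicalClosure
  have hK : IsClosed (K : Set (UnitAddTorus d)) := H.isClosed_topologicalClosure
  have : CompactSpace K := isCompact_iff_compactSpace.mp hK.isCompact
  let μ : Measure K := Measure.addHaarMeasure ⊤
  let ν : Measure (UnitAddTorus d) := Measure.addHaarMeasure ⊤
  have hμ : μ Set.univ = 1 := Measure.addHaarMeasure_self (K₀ := ⊤)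
  have hν : ν Set.univ = 1 := Measure.addHaarMeasure_self (K₀ := ⊤)
  have : IsProbabilityMeasure μ := ⟨hμ⟩
  have : IsProbabilityMeasure ν := ⟨hν⟩
  have hval : Measurable (Subtype.val : K → UnitAddTorus d) := measurable_subtype_coe
  have hμν : μ.map Subtype.val = ν := by
    refine measure_ext_of_integral_mFourier_eq fun n ↦ ?_
    rw [integral_map hval.aemeasurable (mFourier n).continuous.aestronglyMeasurable]
    by_cases hn : n = 0
    · simp [hn, mFourier_zero]
    · obtain ⟨x, hx, hne⟩ := hH n hn
      exact (integral_mFourier_comp_eq_zero K.subtype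
        (g := ⟨x, H.le_topologicalClosure hx⟩) hne).trans
          (integral_mFourier_comp_eq_zero (AddMonoidHom.id _) (g := x) hne).symm
  have hzero : ν (K : Set (UnitAddTorus d))ᶜ = 0 := by
    rw [← hμν, Measure.map_apply hval hK.measurableSet.compl, Set.preimage_compl,
      Subtype.coe_preimage_self, Set.compl_univ, measure_empty]
  have huniv : (K : Set (UnitAddTorus d)) = Set.univ :=
    Set.compl_empty_iff.mp ((hK.isOpen_compl.measure_eq_zero_iff ν).mp hzero)
  exact dense_iff_closure_eq.mpr huniv

theorem Nat.eq_zero_of_sum_mul_log_eq_zero {P : Finset ℕ} (hP : ∀ p ∈ P, p.Prime)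
    {n : P → ℤ} (h : ∑ p : P, (n p : ℝ) * Real.log p = 0) : n = 0 := by
  have hpos (p : P) : (0 : ℝ) < (p : ℕ) := by exact_mod_cast (hP p p.2).pos
  have hprod : ∏ p : P, ((p : ℕ) : ℚ) ^ n p = 1 := by
    have : ∏ p : P, ((p : ℕ) : ℝ) ^ n p = 1 := by
      apply Real.eq_one_of_pos_of_log_eq_zero (Finset.prod_pos fun p _ ↦ zpow_pos (hpos p) _)
      rw [Real.log_prod (fun p _ ↦ (zpow_pos (hpos p) _).ne')]
      simpa [Real.log_zpow] using h
    apply Rat.cast_injective (α := ℝ)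
    push_cast
    exact this
  funext q
  have : Fact (q : ℕ).Prime := ⟨hP q q.2⟩
  have hval (s : Finset P) : padicValRat q (∏ p ∈ s, ((p : ℕ) : ℚ) ^ n p) =
      ∑ p ∈ s, if p = q then n p else 0 := by
    induction s using Finset.induction_on with
    | empty => simp
    | insert p s hps ih =>
      have hne (p : P) : ((p : ℕ) : ℚ) ^ n p ≠ 0 :=
        zpow_ne_zero _ (by exact_mod_cast (hP p p.2).ne_zero)
      rw [Finset.prod_insert hps, Finset.sum_insert hps,
        padicValRat.mul (hne p) (Finset.prod_ne_zero_iff.mpr fun p _ ↦ hne p), ih,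
        padicValRat.zpow]
      have : Fact (p : ℕ).Prime := ⟨hP p p.2⟩
      congr 1
      split_ifs with hpq
      · subst hpq
        simp [padicValRat.self (hP p p.2).one_lt]
      · rw [padicValRat.of_nat, padicValNat_primes fun hqp ↦ hpq (Subtype.ext hqp.symm)]
        simp
  have hsum := hval Finset.univ
  rw [hprod] at hsum
  simpa using hsum.symm

theorem Complex.exists_norm_eq_one_le_norm_one_add (a b : ℂ) :
    ∃ θ : ℂ, ‖θ‖ = 1 ∧ 1 + (‖a‖ + ‖b‖) / 4 ≤ ‖1 + a * θ + b * θ ^ 2‖ := by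
  by_contra! h
  have hre (θ : ℂ) (hθ : ‖θ‖ = 1) : (a * θ).re + (b * θ ^ 2).re < (‖a‖ + ‖b‖) / 4 := by
    have := (Complex.re_le_norm _).trans_lt (h θ hθ)
    simp only [Complex.add_re, Complex.one_re] at this
    linarith
  obtain ⟨u, hu, hau⟩ : ∃ u : ℂ, ‖u‖ = 1 ∧ a * u = ‖a‖ := by
    refine ⟨exp ((-arg a : ℝ) * I), norm_exp_ofReal_mul_I _, ?_⟩
    nth_rewrite 1 [← norm_mul_exp_arg_mul_I a]
    rw [mul_assoc, ← Complex.exp_add]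
    simp
  obtain ⟨v, hv, hbv⟩ : ∃ v : ℂ, ‖v‖ = 1 ∧ b * v ^ 2 = ‖b‖ := by
    refine ⟨exp ((-arg b / 2 : ℝ) * I), norm_exp_ofReal_mul_I _, ?_⟩
    nth_rewrite 1 [← norm_mul_exp_arg_mul_I b]
    rw [mul_assoc, ← Complex.exp_nat_mul, ← Complex.exp_add]
    push_cast
    ring_nf
    simp
  have h₁ := hre u hu
  have h₂ := hre (u * I) (by simp [hu])
  have h₃ := hre (u * -I) (by simp [hu])
  have h₄ := hre v hv
  have h₅ := hre (-v) (by simp [hv])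
  rw [← mul_assoc, hau, mul_pow] at h₂ h₃
  rw [hau] at h₁
  rw [neg_sq, hbv] at h₅
  rw [hbv] at h₄
  simp at h₁ h₂ h₃ h₄ h₅
  linarith [norm_nonneg b]

/-- Kronecker's theorem for the logarithms of primes, in terms of the angles of `p ^ (-it)`. -/
theorem Nat.denseRange_neg_mul_log_div_two_pi {P : Finset ℕ} (hP : ∀ p ∈ P, p.Prime) :
    DenseRange fun (t : ℝ) (p : P) ↦
      ((-(t * Real.log p) / (2 * Real.pi) : ℝ) : UnitAddCircle) := by
  let γ : ℝ →+ UnitAddTorus P :=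
    { toFun t p := ((-(t * Real.log p) / (2 * Real.pi) : ℝ) : UnitAddCircle)
      map_zero' := by ext; simp
      map_add' s t := by
        ext p
        rw [Pi.add_apply, ← AddCircle.coe_add]
        congr 1
        ring }
  have hγ (n : P → ℤ) (t : ℝ) :
      mFourier n (γ t) = exp (-(t * ∑ p : P, (n p : ℝ) * Real.log p : ℝ) * I) := by
    simp only [mFourier, ContinuousMap.coe_mk, γ, AddMonoidHom.coe_mk, ZeroHom.coe_mk,
      fourier_coe_apply, ← Complex.exp_sum]
    congr 1
    push_cast
    rw [Finset.mul_sum, ← Finset.sum_neg_distrib, Finset.sum_mul]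
    refine Finset.sum_congr rfl fun p _ ↦ ?_
    field_simp
  suffices Dense (γ.range : Set (UnitAddTorus P)) by simpa [DenseRange, γ] using this
  refine dense_of_mFourier_ne_one _ fun n hn ↦ ?_
  have hL : ∑ p : P, (n p : ℝ) * Real.log p ≠ 0 :=
    fun h ↦ hn (eq_zero_of_sum_mul_log_eq_zero hP h)
  refine ⟨_, ⟨-Real.pi / ∑ p : P, (n p : ℝ) * Real.log p, rfl⟩, ?_⟩
  rw [hγ, div_mul_cancel₀ _ hL]
  norm_num

/-- Key intermediate inequality in the proof of Theorem 3: for a finite set `P` of primes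
and arbitrary complex data `a(p), b(p)`,
`sup_{t ∈ ℝ} ∏_{p ∈ P} |1 + a(p)·p^{−it} + b(p)·p^{−2it}|
  ≥ ∏_{p ∈ P} (1 + (1/24)·(|a(p)| + |b(p)|))`. -/
theorem sup_prod_twisted_euler_factors_ge
    (P : Finset ℕ) (hP : ∀ p ∈ P, Nat.Prime p) (a b : ℕ → ℂ) :
    (∏ p ∈ P, (1 + (1 / 24) * (‖a p‖ + ‖b p‖))) ≤
      ⨆ t : ℝ, ∏ p ∈ P, ‖1 + a p * Complex.exp (-Complex.I * t * Real.log p) +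
        b p * Complex.exp (-2 * Complex.I * t * Real.log p)‖ := by
  let F : UnitAddTorus P → ℝ := fun x ↦
    ∏ p : P, ‖1 + a p * fourier 1 (x p) + b p * fourier 1 (x p) ^ 2‖
  have hF : Continuous F := by fun_prop
  let γ : ℝ → UnitAddTorus P := fun t p ↦ ((-(t * Real.log p) / (2 * Real.pi) : ℝ) : UnitAddCircle)
  have hFγ (t : ℝ) : ∏ p ∈ P, ‖1 + a p * Complex.exp (-Complex.I * t * Real.log p) +
      b p * Complex.exp (-2 * Complex.I * t * Real.log p)‖ = F (γ t) := by
    rw [← Finset.prod_coe_sort P]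
    refine Finset.prod_congr rfl fun p _ ↦ ?_
    have hexp : fourier 1 (γ t p) = exp (-I * t * Real.log p) := by
      rw [fourier_coe_apply]
      congr 1
      push_cast
      field_simp
    rw [hexp, ← Complex.exp_nat_mul]
    congr 4
    push_cast
    ring
  simp_rw [hFγ]
  have hbdd : BddAbove (Set.range fun t ↦ F (γ t)) :=
    (isCompact_range hF).bddAbove.mono (Set.range_comp_subset_range γ F)
  have hsup (x : UnitAddTorus P) : F x ≤ ⨆ t, F (γ t) :=
    (Nat.denseRange_neg_mul_log_div_two_pi hP).induction_on x
      (isClosed_le hF continuous_const) fun t ↦ le_ciSup hbdd t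
  choose θ hθ hle using fun p : P ↦ exists_norm_eq_one_le_norm_one_add (a p) (b p)
  have hx (p : P) : ∃ x : UnitAddCircle, fourier 1 x = θ p := by
    refine ⟨(arg (θ p) / (2 * Real.pi) : ℝ), ?_⟩
    rw [fourier_coe_apply]
    nth_rewrite 2 [← norm_mul_exp_arg_mul_I (θ p)]
    rw [hθ, ofReal_one, one_mul]
    congr 1
    push_cast
    field_simp
  choose x hx using hx
  refine le_trans ?_ (hsup x)
  rw [← Finset.prod_coe_sort P]
  refine Finset.prod_le_prod (fun p _ ↦ by positivity) fun p _ ↦ ?_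
  rw [hx]
  refine le_trans ?_ (hle p)
  linarith [norm_nonneg (a p), norm_nonneg (b p)]
end

section
/- Let η < A be real numbers and let h be holomorphic on an open set containing the closed strip {s ∈ ℂ : η ≤ Re(s) ≤ A}, with |h(s)| ≤ M on this strip for some M > 0. Let τ ∈ ℝ and ε > 0 be such that |h(A + i(t + τ)) − h(A + it)| ≤ ε for all t ∈ ℝ. Then for every σ with η ≤ σ ≤ A and every t ∈ ℝ, |h(σ + i(t + τ)) − h(σ + it)| ≤ (2M)^{(A−σ)/(A−η)} · ε^{(σ−η)/(A−η)}. -/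
/-- Convexity step in the proof of Theorem 2 (Phragmén–Lindelöf / three-lines theorem):
if `h` is holomorphic on an open set containing the closed strip `η ≤ Re(s) ≤ A`,
bounded by `M` there, and `τ` is an `ε`-almost period of `h` on the line `Re(s) = A`,
then `|h(σ+i(t+τ)) − h(σ+it)| ≤ (2M)^{(A−σ)/(A−η)}·ε^{(σ−η)/(A−η)}` throughout the strip. -/
theorem almost_period_propagates_by_convexity
    (η A : ℝ) (hηA : η < A) (h : ℂ → ℂ) (U : Set ℂ)
    (hU : IsOpen U) (hstrip : {s : ℂ | η ≤ s.re ∧ s.re ≤ A} ⊆ U)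
    (hhol : DifferentiableOn ℂ h U)
    (M : ℝ) (hM : 0 < M)
    (hbdd : ∀ s : ℂ, η ≤ s.re → s.re ≤ A → ‖h s‖ ≤ M)
    (τ : ℝ) (ε : ℝ) (hε : 0 < ε)
    (hap : ∀ t : ℝ, ‖h (A + Complex.I * (t + τ)) - h (A + Complex.I * t)‖ ≤ ε) :
    ∀ σ : ℝ, η ≤ σ → σ ≤ A → ∀ t : ℝ,
      ‖h (σ + Complex.I * (t + τ)) - h (σ + Complex.I * t)‖ ≤
        (2 * M) ^ ((A - σ) / (A - η)) * ε ^ ((σ - η) / (A - η)) := by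
  intro σ hσ₁ hσ₂ t
  let g : ℂ → ℂ := fun s ↦ h (s + Complex.I * τ) - h s
  have hre (s : ℂ) : (s + Complex.I * τ).re = s.re := by simp
  have hg_bdd (s : ℂ) (h₁ : η ≤ s.re) (h₂ : s.re ≤ A) : ‖g s‖ ≤ 2 * M := by
    have hshift := hbdd (s + Complex.I * τ) (by rwa [hre]) (by rwa [hre])
    linarith [norm_sub_le (h (s + Complex.I * τ)) (h s), hbdd s h₁ h₂]
  have hg_right (s : ℂ) (hs : s.re = A) : ‖g s‖ ≤ ε := by
    have hs' : s = A + Complex.I * s.im := by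
      rw [← hs, mul_comm, Complex.re_add_im]
    have hτ := hap s.im
    rwa [mul_add, ← add_assoc, ← hs'] at hτ
  have hg_diff : DiffContOnCl ℂ g (Complex.HadamardThreeLines.verticalStrip η A) := by
    apply DifferentiableOn.diffContOnCl
    rw [Complex.HadamardThreeLines.verticalStrip, Complex.closure_preimage_re,
      closure_Ioo hηA.ne]
    intro s hs
    have hd (z : ℂ) (hz : z.re ∈ Set.Icc η A) : DifferentiableAt ℂ h z :=
      hhol.differentiableAt (hU.mem_nhds (hstrip hz))
    have hshift : DifferentiableAt ℂ h (s + Complex.I * τ) := hd _ (by rwa [hre])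
    exact ((hshift.comp s (differentiableAt_id.add_const _)).sub (hd s hs)).differentiableWithinAt
  have hthree := Complex.HadamardThreeLines.norm_le_interp_of_mem_verticalClosedStrip'
    (f := g) (z := σ + Complex.I * t) (a := 2 * M) (b := ε) hηA
    (by simp [Complex.HadamardThreeLines.verticalClosedStrip, hσ₁, hσ₂]) hg_diff
    ⟨2 * M, by rintro _ ⟨s, hs, rfl⟩; exact hg_bdd s hs.1 hs.2⟩
    (fun s (hs : s.re = η) ↦ hg_bdd s hs.ge (hs.trans_le hηA.le))
    hg_right
  have hexp : 1 - (σ - η) / (A - η) = (A - σ) / (A - η) := by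
    rw [one_sub_div (sub_pos.2 hηA).ne', sub_sub_sub_cancel_right]
  have hz : ((σ : ℂ) + Complex.I * t).re = σ := by simp
  rw [hz, hexp] at hthree
  rwa [mul_add, ← add_assoc]
end
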